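/- For every a > 0 there exist a constant C > 0 and N ∈ ℕ such that for all integers n ≥ N and m ≥ 1 with c := m·n^{−3/2} > a, letting B_c = {σ ∈ S_n : n/2 − √n/(24c) + n^{1/4} ≤ r(σ) ≤ n}, one has |min_{1 ≤ k ≤ m} (U_n(B_c) − Q_{n,k}(B_c)) − Ψ(1/c)| ≤ C·n^{−1/4}. -/

import Mathlib

open Filter MeasureTheory
open scoped BigOperators NNReal ENNReal

noncomputable section

/-- The value of `σ⁻¹` at position `i` (0-indexed), as a natural number; `0` out of range. -/
def invAt (n : ℕ) (σ : Equiv.Perm (Fin n)) (i : ℕ) : ℕ :=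
  if h : i < n then ((σ⁻¹ ⟨i, h⟩ : Fin n) : ℕ) else 0

/-- The number of rising sequences of a permutation: one plus the number of descents
of its inverse. -/
def rSeq (n : ℕ) (σ : Equiv.Perm (Fin n)) : ℕ :=
  1 + ((Finset.range (n - 1)).filter fun i => invAt n σ (i + 1) < invAt n σ i).card

/-- The `m`-shuffle distribution on `S_n`:  `Q_{n,m}(σ) = m^{-n} C(n + m - r(σ), n)`. -/
def Qs (n m : ℕ) (σ : Equiv.Perm (Fin n)) : ℝ :=
  ((m : ℝ) ^ n)⁻¹ * (Nat.choose (n + m - rSeq n σ) n : ℝ)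

/-- The uniform distribution on `S_n`. -/
def Us (n : ℕ) (_ : Equiv.Perm (Fin n)) : ℝ := (n.factorial : ℝ)⁻¹

/-- Total variation distance between two probability distributions on `S_n`. -/
def tv (n : ℕ) (μ ν : Equiv.Perm (Fin n) → ℝ) : ℝ :=
  (1 / 2) * ∑ σ : Equiv.Perm (Fin n), |μ σ - ν σ|

/-- Convolution of two distributions on `S_n`. -/
def convol (n : ℕ) (μ ν : Equiv.Perm (Fin n) → ℝ) : Equiv.Perm (Fin n) → ℝ :=
  fun σ => ∑ τ : Equiv.Perm (Fin n), μ (σ * τ⁻¹) * ν τ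

/-- `k`-fold convolution power; the `0`-th power is the point mass at the identity. -/
def iterConv (n : ℕ) (μ : Equiv.Perm (Fin n) → ℝ) : ℕ → Equiv.Perm (Fin n) → ℝ
  | 0 => fun σ => if σ = 1 then 1 else 0
  | k + 1 => convol n μ (iterConv n μ k)

/-- `Ψ(x) = (2π)^{-1/2} ∫_{-x/(4√3)}^{x/(4√3)} e^{-t²/2} dt`. -/
def Psi (x : ℝ) : ℝ :=
  (Real.sqrt (2 * Real.pi))⁻¹ *
    ∫ t in (-(x / (4 * Real.sqrt 3)))..(x / (4 * Real.sqrt 3)), Real.exp (-t ^ 2 / 2)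

/-- The `p`-shuffle distribution on `S_n` for a probability `p` on the positive integers. -/
def Qp (n : ℕ) (p : ℕ → ℝ) (σ : Equiv.Perm (Fin n)) : ℝ := ∑' m : ℕ, p m * Qs n m σ

/-- The set `B_c` of permutations of `n` cards whose number of rising sequences lies in
`[n/2 - √n/(24c) + n^{1/4}, n]`, where `c = m·n^{-3/2}`. -/
def Bset (n m : ℕ) : Finset (Equiv.Perm (Fin n)) :=
  Finset.univ.filter fun σ =>
    ((n : ℝ) / 2 - Real.sqrt n / (24 * ((m : ℝ) * (n : ℝ) ^ (-(3 / 2) : ℝ))) +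
        (n : ℝ) ^ ((1 : ℝ) / 4) ≤ (rSeq n σ : ℝ)) ∧ rSeq n σ ≤ n

/-! ### The insertion recurrence for rising sequences -/

lemma rSeq_pos (n : ℕ) (σ : Equiv.Perm (Fin n)) : 1 ≤ rSeq n σ := Nat.le_add_right _ _

lemma rSeq_le {n : ℕ} (hn : 1 ≤ n) (σ : Equiv.Perm (Fin n)) : rSeq n σ ≤ n := by
  have h := Finset.card_filter_le (Finset.range (n - 1))
    (fun i => invAt n σ (i + 1) < invAt n σ i)
  rw [Finset.card_range] at h
  unfold rSeq
  omega

/-- The number of descents of a word `w` among its first `N` adjacent pairs. -/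
def wordDescents (N : ℕ) (w : ℕ → ℕ) : ℕ :=
  ((Finset.range N).filter fun i => w (i + 1) < w i).card

lemma wordDescents_succ (N : ℕ) (w : ℕ → ℕ) :
    wordDescents (N + 1) w = wordDescents N w + if w (N + 1) < w N then 1 else 0 := by
  unfold wordDescents
  rw [Finset.range_add_one, Finset.filter_insert]
  split_ifs with h
  · rw [Finset.card_insert_of_notMem (by simp)]
  · simp

lemma wordDescents_congr {N : ℕ} {w w' : ℕ → ℕ} (h : ∀ i ≤ N, w i = w' i) :
    wordDescents N w = wordDescents N w' := by
  unfold wordDescents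
  congr 1
  refine Finset.filter_congr fun i hi => ?_
  rw [Finset.mem_range] at hi
  rw [h i hi.le, h (i + 1) hi]

/-- The word `w` with the letter `a` inserted at position `p`. -/
def insertLetter (a p : ℕ) (w : ℕ → ℕ) (i : ℕ) : ℕ :=
  if i < p then w i else if i = p then a else w (i - 1)

lemma wordDescents_insertLetter {a n : ℕ} {w : ℕ → ℕ} (hw : ∀ i < n, w i < a) {p : ℕ}
    (hp : p < n) {N : ℕ} (hN : p ≤ N) :
    wordDescents (N + 1) (insertLetter a p w) +
      (if 1 ≤ p ∧ w p < w (p - 1) then 1 else 0) = wordDescents N w + 1 := by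
  induction N, hN using Nat.le_induction with
  | base =>
    rw [wordDescents_succ]
    have h1 : insertLetter a p w (p + 1) < insertLetter a p w p := by
      simp [insertLetter, hw p hp]
    rw [if_pos h1]
    rcases p with _ | q
    · simp [wordDescents]
    · rw [wordDescents_succ, wordDescents_succ]
      have h2 : ¬ insertLetter a (q + 1) w (q + 1) < insertLetter a (q + 1) w q := by
        simp [insertLetter, (hw q (by omega)).le]
      rw [if_neg h2, wordDescents_congr (w' := w) fun i hi => by
        simp [insertLetter, show i < q + 1 by omega]]
      simp
      omega
  | succ N hN ih =>
    rw [wordDescents_succ, wordDescents_succ N w]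
    have h1 : insertLetter a p w (N + 1 + 1) = w (N + 1) := by
      simp [insertLetter, show ¬ N + 1 + 1 < p by omega, show N + 1 + 1 ≠ p by omega]
    have h2 : insertLetter a p w (N + 1) = w N := by
      simp [insertLetter, show ¬ N + 1 < p by omega, show N + 1 ≠ p by omega]
    rw [h1, h2]
    omega

lemma wordDescents_insertLetter_last {a n : ℕ} {w : ℕ → ℕ} (hw : ∀ i < n + 1, w i < a) :
    wordDescents (n + 1) (insertLetter a (n + 1) w) = wordDescents n w := by
  rw [wordDescents_succ]
  have h2 : ¬ insertLetter a (n + 1) w (n + 1) < insertLetter a (n + 1) w n := by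
    simp [insertLetter, (hw n (by omega)).le]
  rw [if_neg h2, wordDescents_congr (w' := w) fun i hi => by
    simp [insertLetter, show i < n + 1 by omega]]
  rfl

lemma sum_insertLetter {a n : ℕ} {w : ℕ → ℕ} (hw : ∀ i < n + 1, w i < a) (φ : ℕ → ℝ) :
    ∑ p ∈ Finset.range (n + 2), φ (1 + wordDescents (n + 1) (insertLetter a p w)) =
      (1 + wordDescents n w : ℕ) * φ (1 + wordDescents n w) +
        ((n : ℝ) + 2 - (1 + wordDescents n w : ℕ)) * φ (1 + wordDescents n w + 1) := by
  rw [Finset.sum_range_succ, wordDescents_insertLetter_last hw, Finset.sum_range_succ']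
  have h0 := wordDescents_insertLetter hw (p := 0) (by omega) (N := n) (by omega)
  simp only [nonpos_iff_eq_zero, one_ne_zero, false_and, if_false, add_zero] at h0
  rw [h0]
  have hs : ∀ q ∈ Finset.range n, φ (1 + wordDescents (n + 1) (insertLetter a (q + 1) w)) =
      if w (q + 1) < w q then φ (1 + wordDescents n w) else φ (1 + wordDescents n w + 1) := by
    intro q hq
    rw [Finset.mem_range] at hq
    have h1 := wordDescents_insertLetter hw (p := q + 1) (by omega) (N := n) (by omega)
    simp only [le_add_iff_nonneg_left, zero_le, add_tsub_cancel_right, true_and] at h1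
    split_ifs with h
    · rw [if_pos h] at h1
      congr 2; omega
    · rw [if_neg h] at h1
      congr 1; omega
  rw [Finset.sum_congr rfl hs, Finset.sum_ite, Finset.sum_const, Finset.sum_const]
  have hc := Finset.card_filter_add_card_filter_not (s := Finset.range n)
    (fun q => w (q + 1) < w q)
  rw [Finset.card_range] at hc
  change wordDescents n w + _ = n at hc
  have hc' : ((Finset.filter (fun q => ¬ w (q + 1) < w q) (Finset.range n)).card : ℝ) =
      n - wordDescents n w := by
    rw [eq_sub_iff_add_eq, add_comm]; exact_mod_cast hc
  rw [nsmul_eq_mul, nsmul_eq_mul, hc']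
  change (wordDescents n w : ℝ) * _ + _ + _ + _ = _
  rw [← add_assoc 1 (wordDescents n w) 1]
  push_cast
  ring

/-- Insert the new largest letter at position `p` of the word of `τ⁻¹`. -/
def insertPerm (n : ℕ) (q : Fin (n + 1) × Equiv.Perm (Fin n)) : Equiv.Perm (Fin (n + 1)) :=
  (((finSuccEquiv' q.1).trans (Equiv.optionCongr q.2⁻¹)).trans
    (finSuccEquiv' (Fin.last n)).symm)⁻¹

lemma insertPerm_bijective (n : ℕ) : Function.Bijective (insertPerm n) := by
  rw [Fintype.bijective_iff_injective_and_card]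
  constructor
  · rintro ⟨p, τ⟩ ⟨p', τ'⟩ h
    have h1 : ∀ (q : Fin (n + 1)) (ρ : Equiv.Perm (Fin n)),
        insertPerm n (q, ρ) (Fin.last n) = q := by
      intro q ρ
      rw [insertPerm, Equiv.Perm.inv_def, Equiv.symm_apply_eq]
      simp
    have hp : p = p' := by rw [← h1 p τ, ← h1 p' τ', h]
    subst hp
    have h2 := inv_injective h
    have h3 : Equiv.optionCongr τ⁻¹ = Equiv.optionCongr τ'⁻¹ := by
      ext1 x
      have := congrArg (fun e => (finSuccEquiv' (Fin.last n)) (e ((finSuccEquiv' p).symm x))) h2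
      simpa using this
    rw [inv_injective (Equiv.optionCongr_injective h3)]
  · simp [Fintype.card_perm, Nat.factorial_succ]

lemma invAt_lt {n i : ℕ} (σ : Equiv.Perm (Fin n)) (hi : i < n) : invAt n σ i < n := by
  simp [invAt, hi]

lemma invAt_insertPerm {n : ℕ} (p : Fin (n + 1)) (τ : Equiv.Perm (Fin n)) {i : ℕ}
    (hi : i ≤ n) :
    invAt (n + 1) (insertPerm n (p, τ)) i = insertLetter n p (invAt n τ) i := by
  rw [invAt, dif_pos (by omega), insertPerm, inv_inv]
  simp only [Equiv.trans_apply]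
  rcases lt_trichotomy i p with h | h | h
  · have e : (⟨i, by omega⟩ : Fin (n + 1)) = p.succAbove ⟨i, by omega⟩ := by
      rw [Fin.succAbove_of_castSucc_lt _ _ (by simpa [Fin.lt_def] using h)]
      rfl
    rw [e, finSuccEquiv'_succAbove]
    simp [insertLetter, h, invAt, show i < n by omega]
  · have e : (⟨i, by omega⟩ : Fin (n + 1)) = p := Fin.ext h
    rw [e, finSuccEquiv'_at]
    simp [insertLetter, h]
  · obtain ⟨j, rfl⟩ : ∃ j, i = j + 1 := ⟨i - 1, by omega⟩
    have e : (⟨j + 1, by omega⟩ : Fin (n + 1)) = p.succAbove ⟨j, by omega⟩ := by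
      rw [Fin.succAbove_of_le_castSucc _ _ (by simp [Fin.le_def]; omega)]
      rfl
    rw [e, finSuccEquiv'_succAbove]
    simp [insertLetter, show ¬ j + 1 < (p : ℕ) by omega, show j + 1 ≠ (p : ℕ) by omega, invAt,
      show j < n by omega]

/-- Eulerian recurrence, in the form of a sum over permutations. -/
lemma sum_rSeq_succ (n : ℕ) (φ : ℕ → ℝ) :
    ∑ σ : Equiv.Perm (Fin (n + 2)), φ (rSeq (n + 2) σ) =
      ∑ τ : Equiv.Perm (Fin (n + 1)), ((rSeq (n + 1) τ : ℝ) * φ (rSeq (n + 1) τ) +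
        ((n : ℝ) + 2 - rSeq (n + 1) τ) * φ (rSeq (n + 1) τ + 1)) := by
  rw [← (insertPerm_bijective (n + 1)).sum_comp (fun σ => φ (rSeq (n + 2) σ)),
    Fintype.sum_prod_type, Finset.sum_comm]
  refine Finset.sum_congr rfl fun τ _ => ?_
  have h := sum_insertLetter (a := n + 1) (n := n) (w := invAt (n + 1) τ)
    (fun i hi => invAt_lt τ hi) φ
  rw [← Fin.sum_univ_eq_sum_range
    (fun p => φ (1 + wordDescents (n + 1) (insertLetter (n + 1) p (invAt (n + 1) τ))))] at h
  refine Eq.trans ?_ h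
  refine Finset.sum_congr rfl fun p _ => ?_
  have hd : rSeq (n + 2) (insertPerm (n + 1) (p, τ)) =
      1 + wordDescents (n + 1) (invAt (n + 2) (insertPerm (n + 1) (p, τ))) := rfl
  rw [hd, wordDescents_congr fun i hi => invAt_insertPerm p τ hi]

/-! ### Worpitzky's identity and monotonicity of the shuffle distributions -/

lemma rSeq_one (σ : Equiv.Perm (Fin 1)) : rSeq 1 σ = 1 := by
  simp [rSeq]

lemma choose_insertion_identity {n m r : ℕ} (hr : r ≤ n + 1) :
    (r : ℝ) * ((n + 2 + m - r).choose (n + 2) : ℝ) +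
      ((n : ℝ) + 2 - r) * ((n + 2 + m - (r + 1)).choose (n + 2) : ℝ) =
      m * ((n + 1 + m - r).choose (n + 1) : ℝ) := by
  obtain ⟨N, hN⟩ : ∃ N, N = n + 1 + m - r := ⟨_, rfl⟩
  have e1 : n + 2 + m - r = N + 1 := by omega
  have e2 : n + 2 + m - (r + 1) = N := by omega
  rw [e1, e2, ← hN, Nat.choose_succ_succ N (n + 1)]
  have h := Nat.choose_succ_right_eq N (n + 1)
  have hNm : (N : ℝ) = n + 1 + m - r := by
    rw [hN, Nat.cast_sub (by omega)]; push_cast; ring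
  have h' : (N.choose (n + 1 + 1) : ℝ) * (n + 2) = N.choose (n + 1) * (m - r) := by
    rcases le_or_gt (n + 1) N with hle | hlt
    · have := congrArg (Nat.cast : ℕ → ℝ) h
      push_cast [Nat.cast_sub hle] at this
      rw [hNm] at this
      linear_combination this
    · rw [Nat.choose_eq_zero_of_lt hlt, Nat.choose_eq_zero_of_lt (by omega)]
      simp
  push_cast
  linear_combination h'

/-- Worpitzky's identity. -/
lemma sum_choose_rSeq (n m : ℕ) :
    ∑ σ : Equiv.Perm (Fin (n + 1)), ((n + 1 + m - rSeq (n + 1) σ).choose (n + 1) : ℝ) =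
      (m : ℝ) ^ (n + 1) := by
  induction n with
  | zero => simp [rSeq_one]
  | succ n ih =>
    rw [sum_rSeq_succ n (fun r => ((n + 1 + 1 + m - r).choose (n + 1 + 1) : ℝ)), pow_succ',
      ← ih, Finset.mul_sum]
    exact Finset.sum_congr rfl fun σ _ => choose_insertion_identity (rSeq_le (by omega) σ)

lemma sum_Qs {n m : ℕ} (hn : 1 ≤ n) (hm : 1 ≤ m) :
    ∑ σ : Equiv.Perm (Fin n), Qs n m σ = 1 := by
  obtain ⟨n, rfl⟩ : ∃ k, n = k + 1 := ⟨n - 1, by omega⟩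
  unfold Qs
  rw [← Finset.mul_sum, sum_choose_rSeq]
  exact inv_mul_cancel₀ (by positivity)

lemma choose_mul_choose_le (n A B d : ℕ) (hAB : B ≤ A) :
    A.choose n * (B - d).choose n ≤ (A - d).choose n * B.choose n := by
  have key : A.descFactorial n * (B - d).descFactorial n ≤
      (A - d).descFactorial n * B.descFactorial n := by
    simp only [Nat.descFactorial_eq_prod_range, ← Finset.prod_mul_distrib]
    refine Finset.prod_le_prod' fun i _ => ?_
    rcases le_or_gt (B - i) d with h | h
    · rw [show B - d - i = 0 by omega]; simp
    · obtain ⟨b, hb⟩ : ∃ b, B = b + d + i := ⟨B - d - i, by omega⟩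
      obtain ⟨c, rfl⟩ : ∃ c, A = B + c := ⟨A - B, by omega⟩
      subst hb
      rw [show b + d + i + c - i = b + d + c by omega, show b + d + i - d - i = b by omega,
        show b + d + i + c - d - i = b + c by omega, show b + d + i - i = b + d by omega]
      nlinarith [Nat.zero_le (d * c)]
  simp only [Nat.descFactorial_eq_factorial_mul_choose] at key
  have hf : 0 < n.factorial * n.factorial := by positivity
  refine Nat.le_of_mul_le_mul_left ?_ hf
  linarith

lemma Qs_mul_Qs_le {n k m : ℕ} (hkm : k ≤ m) {σ τ : Equiv.Perm (Fin n)}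
    (h : rSeq n σ ≤ rSeq n τ) : Qs n m σ * Qs n k τ ≤ Qs n m τ * Qs n k σ := by
  have h1 := choose_mul_choose_le n (n + m - rSeq n σ) (n + k - rSeq n σ)
    (rSeq n τ - rSeq n σ) (by omega)
  rw [show n + k - rSeq n σ - (rSeq n τ - rSeq n σ) = n + k - rSeq n τ by omega,
    show n + m - rSeq n σ - (rSeq n τ - rSeq n σ) = n + m - rSeq n τ by omega] at h1
  have h2 : ((n + m - rSeq n σ).choose n : ℝ) * ((n + k - rSeq n τ).choose n : ℝ) ≤
      ((n + m - rSeq n τ).choose n : ℝ) * ((n + k - rSeq n σ).choose n : ℝ) := by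
    exact_mod_cast h1
  have h3 : (0 : ℝ) ≤ ((m : ℝ) ^ n)⁻¹ * ((k : ℝ) ^ n)⁻¹ := by positivity
  unfold Qs
  nlinarith [mul_le_mul_of_nonneg_left h2 h3]

/-- The number of rising sequences is stochastically monotone in the number of piles. -/
lemma sum_Qs_mono {n k m : ℕ} (hn : 1 ≤ n) (hk : 1 ≤ k) (hkm : k ≤ m)
    {B : Finset (Equiv.Perm (Fin n))}
    (hB : ∀ σ ∉ B, ∀ τ ∈ B, rSeq n σ ≤ rSeq n τ) :
    ∑ σ ∈ B, Qs n k σ ≤ ∑ σ ∈ B, Qs n m σ := by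
  have e1 := Finset.sum_add_sum_compl B (Qs n k)
  have e2 := Finset.sum_add_sum_compl B (Qs n m)
  rw [sum_Qs hn hk] at e1
  rw [sum_Qs hn (hk.trans hkm)] at e2
  have h : (∑ σ ∈ Bᶜ, Qs n m σ) * ∑ τ ∈ B, Qs n k τ ≤
      (∑ τ ∈ B, Qs n m τ) * ∑ σ ∈ Bᶜ, Qs n k σ := by
    rw [Finset.sum_mul_sum, Finset.sum_mul_sum, Finset.sum_comm]
    refine Finset.sum_le_sum fun τ hτ => Finset.sum_le_sum fun σ hσ => ?_
    exact Qs_mul_Qs_le hkm (hB σ (Finset.mem_compl.mp hσ) τ hτ)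
  rw [eq_sub_of_add_eq' e1, eq_sub_of_add_eq' e2] at h
  linarith

/-! ### The mean of a function of the number of rising sequences -/

/-- The mean of `φ (r(σ))` over a uniform permutation of `n` letters. -/
def uniformMean (n : ℕ) (φ : ℕ → ℝ) : ℝ := ∑ σ : Equiv.Perm (Fin n), Us n σ * φ (rSeq n σ)

lemma Us_nonneg (n : ℕ) (σ : Equiv.Perm (Fin n)) : 0 ≤ Us n σ := by
  unfold Us; positivity

lemma uniformMean_const (n : ℕ) (c : ℝ) : uniformMean n (fun _ => c) = c := by
  unfold uniformMean Us
  rw [Finset.sum_const, nsmul_eq_mul, Finset.card_univ, Fintype.card_perm, Fintype.card_fin,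
    ← mul_assoc, mul_inv_cancel₀ (by positivity), one_mul]

lemma uniformMean_add (n : ℕ) (φ ψ : ℕ → ℝ) :
    uniformMean n (fun r => φ r + ψ r) = uniformMean n φ + uniformMean n ψ := by
  simp [uniformMean, mul_add, Finset.sum_add_distrib]

lemma uniformMean_const_mul (n : ℕ) (c : ℝ) (φ : ℕ → ℝ) :
    uniformMean n (fun r => c * φ r) = c * uniformMean n φ := by
  simp only [uniformMean, Finset.mul_sum]
  exact Finset.sum_congr rfl fun σ _ => by ring

lemma uniformMean_mono {n : ℕ} (hn : 1 ≤ n) {φ ψ : ℕ → ℝ}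
    (h : ∀ r, 1 ≤ r → r ≤ n → φ r ≤ ψ r) : uniformMean n φ ≤ uniformMean n ψ :=
  Finset.sum_le_sum fun σ _ =>
    mul_le_mul_of_nonneg_left (h _ (rSeq_pos n σ) (rSeq_le hn σ)) (Us_nonneg n σ)

lemma abs_uniformMean_sub_le {n : ℕ} (hn : 1 ≤ n) {φ ψ χ : ℕ → ℝ}
    (h : ∀ r, 1 ≤ r → r ≤ n → |φ r - ψ r| ≤ χ r) :
    |uniformMean n φ - uniformMean n ψ| ≤ uniformMean n χ := by
  rw [abs_sub_le_iff, sub_le_iff_le_add, sub_le_iff_le_add, ← uniformMean_add, ← uniformMean_add]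
  constructor <;> refine uniformMean_mono hn fun r h1 h2 => ?_ <;>
    linarith [abs_sub_le_iff.mp (h r h1 h2)]

lemma uniformMean_one (φ : ℕ → ℝ) : uniformMean 1 φ = φ 1 := by
  simp [uniformMean, rSeq_one, Us]

lemma uniformMean_succ (n : ℕ) (φ : ℕ → ℝ) :
    uniformMean (n + 2) φ = uniformMean (n + 1)
      (fun r => ((r : ℝ) * φ r + ((n : ℝ) + 2 - r) * φ (r + 1)) / ((n : ℝ) + 2)) := by
  unfold uniformMean Us
  rw [← Finset.mul_sum, ← Finset.mul_sum, sum_rSeq_succ, ← Finset.sum_div,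
    Nat.factorial_succ (n + 1)]
  have : (((n + 1).factorial : ℕ) : ℝ) ≠ 0 := by positivity
  push_cast
  field_simp
  ring

lemma uniformMean_sq_le (n : ℕ) :
    uniformMean (n + 1) (fun r => ((r : ℝ) - ((n : ℝ) + 2) / 2) ^ 2) ≤ ((n : ℝ) + 2) / 12 := by
  induction n with
  | zero => rw [uniformMean_one]; norm_num
  | succ n ih =>
    rw [uniformMean_succ]
    have e : ∀ r : ℕ, ((r : ℝ) * ((r : ℝ) - (((n + 1 : ℕ) : ℝ) + 2) / 2) ^ 2 +
        ((n : ℝ) + 2 - r) * (((r + 1 : ℕ) : ℝ) - (((n + 1 : ℕ) : ℝ) + 2) / 2) ^ 2) /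
        ((n : ℝ) + 2) =
        (1 - 2 / ((n : ℝ) + 2)) * ((r : ℝ) - ((n : ℝ) + 2) / 2) ^ 2 + 1 / 4 := by
      intro r
      have : (n : ℝ) + 2 ≠ 0 := by positivity
      push_cast
      field_simp
      ring
    simp only [e]
    rw [uniformMean_add, uniformMean_const, uniformMean_const_mul]
    have h0 : (0 : ℝ) ≤ 1 - 2 / ((n : ℝ) + 2) := by
      rw [sub_nonneg, div_le_one (by positivity)]; linarith [n.cast_nonneg (α := ℝ)]
    have h1 := mul_le_mul_of_nonneg_left ih h0
    have h2 : (1 - 2 / ((n : ℝ) + 2)) * (((n : ℝ) + 2) / 12) = (n : ℝ) / 12 := by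
      field_simp; ring
    push_cast
    linarith

/-! ### Gaussian averages of functions with a fourth order Taylor bound -/

open ProbabilityTheory in
/-- The average of `f (x + z)` over a centered Gaussian `z` of variance `w`. -/
def gaussAvg (w : ℝ≥0) (f : ℝ → ℝ) (x : ℝ) : ℝ := ∫ z, f (x + z) ∂gaussianReal 0 w

/-- `f` is bounded and has a third order Taylor expansion with bounded coefficients `f₁, f₂, f₃`
and a fourth order remainder. -/
structure FourthOrder (f f₁ f₂ f₃ : ℝ → ℝ) (B B₂ B₃ B₄ : ℝ) : Prop where
  cont : Continuous f
  cont₁ : Continuous f₁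
  cont₂ : Continuous f₂
  cont₃ : Continuous f₃
  bdd : ∀ x, |f x| ≤ B
  bdd₁ : ∀ x, |f₁ x| ≤ B
  bdd₂ : ∀ x, |f₂ x| ≤ B₂
  bdd₃ : ∀ x, |f₃ x| ≤ B₃
  taylor : ∀ x y, |f (x + y) - (f x + f₁ x * y + f₂ x * y ^ 2 / 2 + f₃ x * y ^ 3 / 6)| ≤
    B₄ * y ^ 4

section GaussAvg

open ProbabilityTheory

lemma integrable_of_continuous_of_bdd {f : ℝ → ℝ} {B : ℝ} (hf : Continuous f)
    (hB : ∀ x, |f x| ≤ B) (μ : Measure ℝ) [IsFiniteMeasure μ] : Integrable f μ :=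
  Integrable.of_bound hf.aestronglyMeasurable B (ae_of_all _ hB)

lemma integrable_shift {f : ℝ → ℝ} {B : ℝ} (hf : Continuous f) (hB : ∀ x, |f x| ≤ B)
    (w : ℝ≥0) (x : ℝ) : Integrable (fun z => f (x + z)) (gaussianReal 0 w) :=
  integrable_of_continuous_of_bdd (by fun_prop) (fun z => hB (x + z)) _

lemma abs_integral_gaussian_le {f : ℝ → ℝ} {B : ℝ} (hB : ∀ x, |f x| ≤ B) (w : ℝ≥0) :
    |∫ z, f z ∂gaussianReal 0 w| ≤ B := by
  have := norm_integral_le_of_norm_le_const (μ := gaussianReal 0 w) (f := f) (C := B)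
    (ae_of_all _ fun x => by simpa using hB x)
  simpa using this

lemma integral_sub_sum_four {μ : Measure ℝ} {g a b c d : ℝ → ℝ} (hg : Integrable g μ)
    (ha : Integrable a μ) (hb : Integrable b μ) (hc : Integrable c μ) (hd : Integrable d μ) :
    ∫ z, (g z - (a z + b z + c z + d z)) ∂μ =
      ∫ z, g z ∂μ - (∫ z, a z ∂μ + ∫ z, b z ∂μ + ∫ z, c z ∂μ + ∫ z, d z ∂μ) := by
  have h2 : Integrable (fun z => a z + b z) μ := ha.add hb
  have h3 : Integrable (fun z => a z + b z + c z) μ := h2.add hc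
  have h4 : Integrable (fun z => a z + b z + c z + d z) μ := h3.add hd
  rw [integral_sub hg h4, integral_add h3 hd, integral_add h2 hc, integral_add ha hb]

lemma continuous_gaussAvg {f : ℝ → ℝ} {B : ℝ} (hf : Continuous f) (hB : ∀ x, |f x| ≤ B)
    (w : ℝ≥0) : Continuous (gaussAvg w f) := by
  refine continuous_of_dominated (bound := fun _ => B) (fun x => ?_) (fun x => ?_)
    (integrable_const B) (ae_of_all _ fun z => by fun_prop)
  · exact (hf.comp (continuous_const.add continuous_id)).aestronglyMeasurable
  · exact ae_of_all _ fun z => hB (x + z)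

lemma abs_gaussAvg_le {f : ℝ → ℝ} {B : ℝ} (hB : ∀ x, |f x| ≤ B) (w : ℝ≥0) (x : ℝ) :
    |gaussAvg w f x| ≤ B :=
  abs_integral_gaussian_le (fun z => hB (x + z)) w

lemma FourthOrder.averaged {f f₁ f₂ f₃ : ℝ → ℝ} {B B₂ B₃ B₄ : ℝ}
    (h : FourthOrder f f₁ f₂ f₃ B B₂ B₃ B₄) (w : ℝ≥0) :
    FourthOrder (gaussAvg w f) (gaussAvg w f₁) (gaussAvg w f₂) (gaussAvg w f₃) B B₂ B₃ B₄ where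
  cont := continuous_gaussAvg h.cont h.bdd w
  cont₁ := continuous_gaussAvg h.cont₁ h.bdd₁ w
  cont₂ := continuous_gaussAvg h.cont₂ h.bdd₂ w
  cont₃ := continuous_gaussAvg h.cont₃ h.bdd₃ w
  bdd := abs_gaussAvg_le h.bdd w
  bdd₁ := abs_gaussAvg_le h.bdd₁ w
  bdd₂ := abs_gaussAvg_le h.bdd₂ w
  bdd₃ := abs_gaussAvg_le h.bdd₃ w
  taylor x y := by
    have i0 := integrable_shift h.cont h.bdd w x
    have i1 := (integrable_shift h.cont₁ h.bdd₁ w x).mul_const y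
    have i2 := ((integrable_shift h.cont₂ h.bdd₂ w x).mul_const (y ^ 2)).div_const 2
    have i3 := ((integrable_shift h.cont₃ h.bdd₃ w x).mul_const (y ^ 3)).div_const 6
    have iy := integrable_shift h.cont h.bdd w (x + y)
    have e : gaussAvg w f (x + y) - (gaussAvg w f x + gaussAvg w f₁ x * y +
        gaussAvg w f₂ x * y ^ 2 / 2 + gaussAvg w f₃ x * y ^ 3 / 6) =
        ∫ z, (f (x + y + z) - (f (x + z) + f₁ (x + z) * y + f₂ (x + z) * y ^ 2 / 2 +
          f₃ (x + z) * y ^ 3 / 6)) ∂gaussianReal 0 w := by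
      rw [integral_sub_sum_four iy i0 i1 i2 i3, integral_mul_const, integral_div,
        integral_mul_const, integral_div, integral_mul_const]
      rfl
    rw [e]
    refine abs_integral_gaussian_le (fun z => ?_) w
    have := h.taylor (x + z) y
    rwa [add_right_comm] at this

lemma integral_gaussAvg {f : ℝ → ℝ} {B : ℝ} (hf : Continuous f) (hB : ∀ x, |f x| ≤ B)
    (v w : ℝ≥0) :
    ∫ x, gaussAvg w f x ∂gaussianReal 0 v = ∫ x, f x ∂gaussianReal 0 (v + w) := by
  have h := gaussianReal_conv_gaussianReal (m₁ := 0) (m₂ := 0) (v₁ := v) (v₂ := w)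
  rw [add_zero] at h
  rw [← h, integral_conv]
  · rfl
  · exact integrable_of_continuous_of_bdd hf hB _

lemma integrable_pow_gaussianReal (w : ℝ≥0) (k : ℕ) :
    Integrable (fun z : ℝ => z ^ k) (gaussianReal 0 w) := by
  have h := (memLp_id_gaussianReal (μ := 0) (v := w) (k : ℝ≥0)).integrable_norm_pow'
  refine (integrable_norm_iff (by fun_prop)).mp ?_
  simpa [norm_pow] using h

lemma gaussianReal_eq_map_sqrt (w : ℝ≥0) :
    gaussianReal 0 w = (gaussianReal 0 1).map (fun z => √(w : ℝ) * z) := by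
  rw [gaussianReal_map_const_mul, mul_zero, mul_one]
  congr 1
  ext
  simp

lemma integral_gaussianReal_eq_sqrt {f : ℝ → ℝ} (hf : Continuous f) (w : ℝ≥0) :
    ∫ z, f z ∂gaussianReal 0 w = ∫ z, f (√(w : ℝ) * z) ∂gaussianReal 0 1 := by
  rw [gaussianReal_eq_map_sqrt, integral_map (by fun_prop) hf.aestronglyMeasurable]

lemma integral_sq_gaussianReal (w : ℝ≥0) : ∫ z, z ^ 2 ∂gaussianReal 0 w = w := by
  have h := variance_fun_id_gaussianReal (μ := 0) (v := w)
  rw [variance_of_integral_eq_zero (by fun_prop) (by simp)] at h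
  simpa using h

lemma integral_cube_gaussianReal (w : ℝ≥0) : ∫ z, z ^ 3 ∂gaussianReal 0 w = 0 := by
  have h : ∫ z, z ^ 3 ∂gaussianReal 0 w = ∫ z, (-z) ^ 3 ∂gaussianReal 0 w := by
    conv_lhs => rw [← neg_zero (G := ℝ), ← gaussianReal_map_neg]
    rw [integral_map (by fun_prop) (by fun_prop)]
  have e : ∀ z : ℝ, (-z) ^ 3 = -(z ^ 3) := fun z => by ring
  simp only [e, integral_neg] at h
  linarith

lemma integral_fourth_gaussianReal (w : ℝ≥0) :
    ∫ z, z ^ 4 ∂gaussianReal 0 w = (∫ z, z ^ 4 ∂gaussianReal 0 1) * (w : ℝ) ^ 2 := by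
  rw [integral_gaussianReal_eq_sqrt (by fun_prop), ← integral_mul_const]
  refine integral_congr_ae (ae_of_all _ fun z => ?_)
  have := Real.sq_sqrt (NNReal.coe_nonneg w)
  change (√(w : ℝ) * z) ^ 4 = z ^ 4 * (w : ℝ) ^ 2
  linear_combination z ^ 4 * (√(w : ℝ) ^ 2 + w) * this

lemma FourthOrder.abs_gaussAvg_sub_le {f f₁ f₂ f₃ : ℝ → ℝ} {B B₂ B₃ B₄ : ℝ}
    (h : FourthOrder f f₁ f₂ f₃ B B₂ B₃ B₄) (w : ℝ≥0) (x : ℝ) :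
    |gaussAvg w f x - (f x + f₂ x * w / 2)| ≤
      B₄ * ((∫ z, z ^ 4 ∂gaussianReal 0 1) * (w : ℝ) ^ 2) := by
  have i1 := (integrable_pow_gaussianReal w 1).const_mul (f₁ x)
  have i2 := ((integrable_pow_gaussianReal w 2).const_mul (f₂ x)).div_const 2
  have i3 := ((integrable_pow_gaussianReal w 3).const_mul (f₃ x)).div_const 6
  have i4 := (integrable_pow_gaussianReal w 4).const_mul B₄
  have i0 : Integrable (fun _ : ℝ => f x) (gaussianReal 0 w) := integrable_const _
  simp only [pow_one] at i1
  have e : gaussAvg w f x - (f x + f₂ x * w / 2) =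
      ∫ z, (f (x + z) - (f x + f₁ x * z + f₂ x * z ^ 2 / 2 + f₃ x * z ^ 3 / 6))
        ∂gaussianReal 0 w := by
    rw [integral_sub_sum_four (integrable_shift h.cont h.bdd w x) i0 i1 i2 i3,
      integral_const_mul, integral_div,
      integral_const_mul, integral_div, integral_const_mul, integral_sq_gaussianReal,
      integral_cube_gaussianReal, integral_id_gaussianReal]
    simp [gaussAvg]
  rw [e, ← integral_fourth_gaussianReal, ← integral_const_mul]
  rw [← Real.norm_eq_abs]
  exact norm_integral_le_of_norm_le i4 (ae_of_all _ fun z => h.taylor x z)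

end GaussAvg

/-! ### The Lindeberg comparison along the Eulerian recurrence -/

lemma FourthOrder.abs_twoPoint_sub_le {f f₁ f₂ f₃ : ℝ → ℝ} {B B₂ B₃ B₄ : ℝ}
    (h : FourthOrder f f₁ f₂ f₃ B B₂ B₃ B₄) {y D K : ℝ} (hK : 0 < K) (hD : |D| ≤ K / 2) :
    |((D + K / 2) / K * f (y + (D - K / 2)) + (K / 2 - D) / K * f (y + (D + K / 2))) -
      (f y + f₂ y * (K ^ 2 / 4) / 2)| ≤ B₂ * D ^ 2 + B₃ * (K ^ 2 * |D|) + B₄ * K ^ 4 := by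
  have hD' := abs_le.mp hD
  have t1 := h.taylor y (D - K / 2)
  have t2 := h.taylor y (D + K / 2)
  set R₁ := f (y + (D - K / 2)) - (f y + f₁ y * (D - K / 2) + f₂ y * (D - K / 2) ^ 2 / 2 +
    f₃ y * (D - K / 2) ^ 3 / 6) with hR₁
  set R₂ := f (y + (D + K / 2)) - (f y + f₁ y * (D + K / 2) + f₂ y * (D + K / 2) ^ 2 / 2 +
    f₃ y * (D + K / 2) ^ 3 / 6) with hR₂
  have hB₄ : 0 ≤ B₄ := by
    have := (abs_nonneg _).trans (h.taylor y 1)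
    simpa using this
  have p1 : 0 ≤ (D + K / 2) / K := div_nonneg (by linarith) hK.le
  have p2 : 0 ≤ (K / 2 - D) / K := div_nonneg (by linarith) hK.le
  have psum : (D + K / 2) / K + (K / 2 - D) / K = 1 := by field_simp; ring
  have q : 0 ≤ K ^ 2 / 4 - D ^ 2 := by nlinarith
  have e : ((D + K / 2) / K * f (y + (D - K / 2)) + (K / 2 - D) / K * f (y + (D + K / 2))) -
      (f y + f₂ y * (K ^ 2 / 4) / 2) =
      -(f₂ y * (D ^ 2 / 2)) + f₃ y * ((K ^ 2 / 4 - D ^ 2) * D / 3) +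
        ((D + K / 2) / K * R₁ + (K / 2 - D) / K * R₂) := by
    have e1 : f (y + (D - K / 2)) = R₁ + (f y + f₁ y * (D - K / 2) +
      f₂ y * (D - K / 2) ^ 2 / 2 + f₃ y * (D - K / 2) ^ 3 / 6) := by rw [hR₁]; ring
    have e2 : f (y + (D + K / 2)) = R₂ + (f y + f₁ y * (D + K / 2) +
      f₂ y * (D + K / 2) ^ 2 / 2 + f₃ y * (D + K / 2) ^ 3 / 6) := by rw [hR₂]; ring
    rw [e1, e2]
    field_simp
    ring
  have pow4 : ∀ u : ℝ, |u| ≤ K → B₄ * u ^ 4 ≤ B₄ * K ^ 4 := fun u hu => by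
    have := pow_le_pow_left₀ (abs_nonneg u) hu 4
    rw [Even.pow_abs (by decide)] at this
    exact mul_le_mul_of_nonneg_left this hB₄
  have r1 : |R₁| ≤ B₄ * K ^ 4 := t1.trans (pow4 _ (abs_le.mpr ⟨by linarith, by linarith⟩))
  have r2 : |R₂| ≤ B₄ * K ^ 4 := t2.trans (pow4 _ (abs_le.mpr ⟨by linarith, by linarith⟩))
  have a1 : |-(f₂ y * (D ^ 2 / 2))| ≤ B₂ * D ^ 2 := by
    rw [abs_neg, abs_mul, abs_of_nonneg (by positivity : 0 ≤ D ^ 2 / 2)]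
    have hb := h.bdd₂ y
    nlinarith [abs_nonneg (f₂ y), sq_nonneg D, mul_le_mul_of_nonneg_right hb (sq_nonneg D)]
  have a2 : |f₃ y * ((K ^ 2 / 4 - D ^ 2) * D / 3)| ≤ B₃ * (K ^ 2 * |D|) := by
    rw [abs_mul]
    have hb := h.bdd₃ y
    have hc : |(K ^ 2 / 4 - D ^ 2) * D / 3| ≤ K ^ 2 * |D| := by
      rw [abs_div, abs_mul, abs_of_nonneg q, abs_of_pos (by norm_num : (0 : ℝ) < 3)]
      have : (K ^ 2 / 4 - D ^ 2) / 3 ≤ K ^ 2 := by nlinarith [sq_nonneg D, sq_nonneg K]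
      calc (K ^ 2 / 4 - D ^ 2) * |D| / 3 = (K ^ 2 / 4 - D ^ 2) / 3 * |D| := by ring
        _ ≤ _ := mul_le_mul_of_nonneg_right this (abs_nonneg D)
    exact mul_le_mul hb hc (abs_nonneg _) ((abs_nonneg _).trans hb)
  have a3 : |(D + K / 2) / K * R₁ + (K / 2 - D) / K * R₂| ≤ B₄ * K ^ 4 := by
    calc |(D + K / 2) / K * R₁ + (K / 2 - D) / K * R₂|
        ≤ |(D + K / 2) / K * R₁| + |(K / 2 - D) / K * R₂| := abs_add_le _ _
      _ = (D + K / 2) / K * |R₁| + (K / 2 - D) / K * |R₂| := by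
          rw [abs_mul, abs_mul, abs_of_nonneg p1, abs_of_nonneg p2]
      _ ≤ (D + K / 2) / K * (B₄ * K ^ 4) + (K / 2 - D) / K * (B₄ * K ^ 4) := by gcongr
      _ = B₄ * K ^ 4 := by rw [← add_mul, psum, one_mul]
  rw [e]
  exact (abs_add_le _ _).trans (add_le_add ((abs_add_le _ _).trans (add_le_add a1 a2)) a3)

/-- The variance of the Gaussian compared with `n (r - (n + 1) / 2)` on `S_n`, indexed from
`n = 1`. -/
def lindebergVar (n : ℕ) : ℝ≥0 := ∑ i ∈ Finset.range n, ((i : ℝ≥0) + 2) ^ 2 / 4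

lemma coe_lindebergVar (n : ℕ) :
    (lindebergVar n : ℝ) = (((n : ℝ) + 1) * (n + 2) * (2 * n + 3) / 6 - 1) / 4 := by
  induction n with
  | zero => norm_num [lindebergVar]
  | succ n ih =>
    rw [lindebergVar, Finset.sum_range_succ, NNReal.coe_add, ← lindebergVar, ih]
    push_cast
    ring

/-- The fourth moment of the standard Gaussian. -/
def gaussFourth : ℝ := ∫ z, z ^ 4 ∂ProbabilityTheory.gaussianReal 0 1

lemma gaussFourth_nonneg : 0 ≤ gaussFourth :=
  integral_nonneg fun z => Even.pow_nonneg (by decide) z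

lemma FourthOrder.abs_uniformMean_succ_sub_le {f f₁ f₂ f₃ : ℝ → ℝ} {B B₂ B₃ B₄ : ℝ}
    (h : FourthOrder f f₁ f₂ f₃ B B₂ B₃ B₄) {n : ℕ} {q : ℝ} (hq : 0 < q) :
    |uniformMean (n + 2) (fun r => f (((n : ℝ) + 2) * (r - ((n : ℝ) + 3) / 2))) -
      uniformMean (n + 1) (fun r => gaussAvg (((n : ℝ≥0) + 2) ^ 2 / 4) f
        (((n : ℝ) + 1) * (r - ((n : ℝ) + 2) / 2)))| ≤
      B₂ * (n + 2) + B₃ * ((n + 2) ^ 2 * ((n + 2) / q + q)) +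
        B₄ * ((1 + gaussFourth) * (n + 2) ^ 4) := by
  set K : ℝ := (n : ℝ) + 2 with hK
  have hKpos : 0 < K := by positivity
  have hB₂ : 0 ≤ B₂ := (abs_nonneg _).trans (h.bdd₂ 0)
  have hB₃ : 0 ≤ B₃ := (abs_nonneg _).trans (h.bdd₃ 0)
  have hB₄ : 0 ≤ B₄ := by
    have := (abs_nonneg _).trans (h.taylor 0 1)
    simpa using this
  rw [uniformMean_succ]
  refine (abs_uniformMean_sub_le (by omega) (χ := fun r => (B₂ + B₃ * (K ^ 2 / q)) *
    ((r : ℝ) - K / 2) ^ 2 + (B₃ * (K ^ 2 * q) + B₄ * ((1 + gaussFourth) * K ^ 4)))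
    fun r hr1 hr2 => ?_).trans ?_
  · have hr1' : (1 : ℝ) ≤ r := by exact_mod_cast hr1
    have hr2' : (r : ℝ) ≤ n + 1 := by exact_mod_cast hr2
    set D : ℝ := (r : ℝ) - K / 2 with hD
    have hDK : |D| ≤ K / 2 := abs_le.mpr ⟨by linarith, by linarith⟩
    have t := h.abs_twoPoint_sub_le (y := ((n : ℝ) + 1) * D) hKpos hDK
    have g := h.abs_gaussAvg_sub_le (((n : ℝ≥0) + 2) ^ 2 / 4) (((n : ℝ) + 1) * D)
    have hw : ((((n : ℝ≥0) + 2) ^ 2 / 4 : ℝ≥0) : ℝ) = K ^ 2 / 4 := by push_cast; rfl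
    rw [hw] at g
    change _ ≤ B₄ * (gaussFourth * _) at g
    have e : ((r : ℝ) * f (K * (r - ((n : ℝ) + 3) / 2)) +
        (K - r) * f (K * ((r + 1 : ℕ) - ((n : ℝ) + 3) / 2))) / K =
        (D + K / 2) / K * f (((n : ℝ) + 1) * D + (D - K / 2)) +
        (K / 2 - D) / K * f (((n : ℝ) + 1) * D + (D + K / 2)) := by
      rw [show K * (r - ((n : ℝ) + 3) / 2) = ((n : ℝ) + 1) * D + (D - K / 2) by
          rw [hD, hK]; ring,
        show K * ((r + 1 : ℕ) - ((n : ℝ) + 3) / 2) = ((n : ℝ) + 1) * D + (D + K / 2) by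
          rw [hD, hK]; push_cast; ring,
        show D + K / 2 = r by rw [hD]; ring, show K / 2 - D = K - r by rw [hD]; ring]
      ring
    rw [e]
    have hDq : |D| ≤ D ^ 2 / q + q := by
      have : |D| * q ≤ D ^ 2 + q ^ 2 := by
        nlinarith [sq_nonneg (|D| - q), sq_abs D, mul_nonneg (abs_nonneg D) hq.le]
      calc |D| = |D| * q / q := by field_simp
        _ ≤ (D ^ 2 + q ^ 2) / q := by gcongr
        _ = _ := by field_simp
    have hm : B₃ * (K ^ 2 * |D|) ≤ B₃ * (K ^ 2 * (D ^ 2 / q + q)) := by gcongr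
    have hM : B₄ * (gaussFourth * (K ^ 2 / 4) ^ 2) ≤ B₄ * (gaussFourth * K ^ 4) := by
      have : (K ^ 2 / 4) ^ 2 ≤ K ^ 4 := by nlinarith [pow_pos hKpos 4]
      exact mul_le_mul_of_nonneg_left
        (mul_le_mul_of_nonneg_left this gaussFourth_nonneg) hB₄
    rw [abs_sub_comm] at g
    refine (abs_sub_le _ (f (((n : ℝ) + 1) * D) + f₂ (((n : ℝ) + 1) * D) * (K ^ 2 / 4) / 2)
      _).trans ?_
    refine (add_le_add t g).trans ?_
    have : (B₂ + B₃ * (K ^ 2 / q)) * D ^ 2 + (B₃ * (K ^ 2 * q) +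
        B₄ * ((1 + gaussFourth) * K ^ 4)) = B₂ * D ^ 2 + B₃ * (K ^ 2 * (D ^ 2 / q + q)) +
        B₄ * K ^ 4 + B₄ * (gaussFourth * K ^ 4) := by ring
    rw [this]
    linarith
  · rw [uniformMean_add, uniformMean_const, uniformMean_const_mul]
    have hs : uniformMean (n + 1) (fun r => ((r : ℝ) - K / 2) ^ 2) ≤ K :=
      (uniformMean_sq_le n).trans (by linarith)
    have h0 : 0 ≤ B₂ + B₃ * (K ^ 2 / q) := by positivity
    have := mul_le_mul_of_nonneg_left hs h0
    have e : B₂ * K + B₃ * (K ^ 2 * (K / q + q)) + B₄ * ((1 + gaussFourth) * K ^ 4) =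
      (B₂ + B₃ * (K ^ 2 / q)) * K + (B₃ * (K ^ 2 * q) + B₄ * ((1 + gaussFourth) * K ^ 4)) := by
      ring
    rw [e]
    linarith

open ProbabilityTheory in
/-- Gaussian approximation for smooth functions of the number of rising sequences. -/
lemma abs_uniformMean_sub_gaussian_le {N q : ℝ} (hq : 0 < q) (n : ℕ) (hn : (n : ℝ) + 1 ≤ N)
    {f f₁ f₂ f₃ : ℝ → ℝ} {B B₂ B₃ B₄ : ℝ} (h : FourthOrder f f₁ f₂ f₃ B B₂ B₃ B₄) :
    |uniformMean (n + 1) (fun r => f (((n : ℝ) + 1) * (r - ((n : ℝ) + 2) / 2))) -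
      ∫ z, f z ∂gaussianReal 0 (lindebergVar n)| ≤
      n * (B₂ * N + B₃ * (N ^ 2 * (N / q + q)) + B₄ * ((1 + gaussFourth) * N ^ 4)) := by
  induction n generalizing f f₁ f₂ f₃ with
  | zero => rw [uniformMean_one]; norm_num [lindebergVar, gaussianReal_zero_var]
  | succ n ih =>
    push_cast at hn ⊢
    have hB₂ : 0 ≤ B₂ := (abs_nonneg _).trans (h.bdd₂ 0)
    have hB₃ : 0 ≤ B₃ := (abs_nonneg _).trans (h.bdd₃ 0)
    have hB₄ : 0 ≤ B₄ := by
      have := (abs_nonneg _).trans (h.taylor 0 1)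
      simpa using this
    have hN : (n : ℝ) + 2 ≤ N := by linarith
    have i := ih (by linarith) (h.averaged (((n : ℝ≥0) + 2) ^ 2 / 4))
    have s := h.abs_uniformMean_succ_sub_le (n := n) hq
    rw [integral_gaussAvg h.cont h.bdd] at i
    have ev : lindebergVar (n + 1) = lindebergVar n + ((n : ℝ≥0) + 2) ^ 2 / 4 := by
      rw [lindebergVar, Finset.sum_range_succ]; rfl
    rw [ev]
    have hb : B₂ * ((n : ℝ) + 2) + B₃ * (((n : ℝ) + 2) ^ 2 * (((n : ℝ) + 2) / q + q)) +
        B₄ * ((1 + gaussFourth) * ((n : ℝ) + 2) ^ 4) ≤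
        B₂ * N + B₃ * (N ^ 2 * (N / q + q)) + B₄ * ((1 + gaussFourth) * N ^ 4) := by
      have := gaussFourth_nonneg
      gcongr
    have e1 : (n : ℝ) + 1 + 1 = n + 2 := by ring
    have e2 : (n : ℝ) + 1 + 2 = n + 3 := by ring
    rw [e1, e2]
    refine (abs_sub_le _ _ _).trans ((add_le_add s i).trans ?_)
    linarith

/-! ### Smoothing by iterated box averages -/

lemma abs_le_pow_succ_of_hasDerivAt {g g' : ℝ → ℝ} {M : ℝ} {k : ℕ} (h0 : g 0 = 0) (hM : 0 ≤ M)
    (hg : ∀ t, HasDerivAt g (g' t) t) (hb : ∀ t, |g' t| ≤ M * |t| ^ k) (t : ℝ) :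
    |g t| ≤ M * |t| ^ (k + 1) := by
  have h := (convex_closedBall (0 : ℝ) |t|).norm_image_sub_le_of_norm_hasDerivWithin_le
    (f := g) (f' := g') (C := M * |t| ^ k) (fun u _ => (hg u).hasDerivWithinAt)
    (fun u hu => by
      rw [mem_closedBall_zero_iff, Real.norm_eq_abs] at hu
      rw [Real.norm_eq_abs]
      refine (hb u).trans ?_
      gcongr)
    (x := 0) (y := t) (by simp) (by simp)
  rw [h0, sub_zero, sub_zero, Real.norm_eq_abs, Real.norm_eq_abs] at h
  rw [pow_succ, ← mul_assoc]
  exact h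

lemma abs_taylor_four_le {f f₁ f₂ f₃ f₄ : ℝ → ℝ} {M : ℝ} (h0 : ∀ x, HasDerivAt f (f₁ x) x)
    (h1 : ∀ x, HasDerivAt f₁ (f₂ x) x) (h2 : ∀ x, HasDerivAt f₂ (f₃ x) x)
    (h3 : ∀ x, HasDerivAt f₃ (f₄ x) x) (hM : ∀ x, |f₄ x| ≤ M) (x y : ℝ) :
    |f (x + y) - (f x + f₁ x * y + f₂ x * y ^ 2 / 2 + f₃ x * y ^ 3 / 6)| ≤ M * y ^ 4 := by
  have hM0 : 0 ≤ M := (abs_nonneg _).trans (hM 0)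
  have sh : ∀ {g g' : ℝ → ℝ}, (∀ x, HasDerivAt g (g' x) x) → ∀ t,
      HasDerivAt (fun t => g (x + t)) (g' (x + t)) t := fun hg t => (hg (x + t)).comp_const_add x t
  have lin : ∀ c t : ℝ, HasDerivAt (fun t => c * t) c t := fun c t => by
    simpa using (hasDerivAt_id t).const_mul c
  have quad : ∀ c t : ℝ, HasDerivAt (fun t => c * t ^ 2 / 2) (c * t) t := fun c t => by
    refine (((hasDerivAt_pow 2 t).const_mul c).div_const 2).congr_deriv ?_
    norm_num
    ring
  have cub : ∀ c t : ℝ, HasDerivAt (fun t => c * t ^ 3 / 6) (c * t ^ 2 / 2) t := fun c t => by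
    refine (((hasDerivAt_pow 3 t).const_mul c).div_const 6).congr_deriv ?_
    norm_num
    ring
  have b3 := abs_le_pow_succ_of_hasDerivAt (g := fun t => f₃ (x + t) - f₃ x) (k := 0)
    (by simp) hM0 (fun t => (sh h3 t).sub_const (f₃ x)) (fun t => by simpa using hM (x + t))
  have b2 := abs_le_pow_succ_of_hasDerivAt (g := fun t => f₂ (x + t) - (f₂ x + f₃ x * t))
    (by simp) hM0 (fun t => (sh h2 t).sub ((lin (f₃ x) t).const_add (f₂ x))) b3
  have b1 := abs_le_pow_succ_of_hasDerivAt
    (g := fun t => f₁ (x + t) - (f₁ x + f₂ x * t + f₃ x * t ^ 2 / 2))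
    (by simp) hM0 (fun t => (sh h1 t).sub
      (((lin (f₂ x) t).const_add (f₁ x)).add (quad (f₃ x) t))) b2
  have b0 := abs_le_pow_succ_of_hasDerivAt
    (g := fun t => f (x + t) - (f x + f₁ x * t + f₂ x * t ^ 2 / 2 + f₃ x * t ^ 3 / 6))
    (by simp) hM0 (fun t => (sh h0 t).sub
      ((((lin (f₁ x) t).const_add (f x)).add (quad (f₂ x) t)).add (cub (f₃ x) t))) b1 y
  rwa [Even.pow_abs (by decide)] at b0

/-- The average of `G` over `[x, x + δ]`. -/
def boxAvg (δ : ℝ) (G : ℝ → ℝ) (x : ℝ) : ℝ := δ⁻¹ * ∫ t in x..(x + δ), G t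

/-- The difference quotient of `G` with step `δ`. -/
def boxDiff (δ : ℝ) (G : ℝ → ℝ) (x : ℝ) : ℝ := δ⁻¹ * (G (x + δ) - G x)

lemma hasDerivAt_boxAvg {G : ℝ → ℝ} (hG : Continuous G) (δ x : ℝ) :
    HasDerivAt (boxAvg δ G) (boxDiff δ G x) x := by
  have e : boxAvg δ G =
      fun x => δ⁻¹ * ((∫ t in (0 : ℝ)..(x + δ), G t) - ∫ t in (0 : ℝ)..x, G t) := by
    funext x
    rw [boxAvg, intervalIntegral.integral_interval_sub_left (hG.intervalIntegrable _ _)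
      (hG.intervalIntegrable _ _)]
  rw [e]
  have h1 := (hG.integral_hasStrictDerivAt 0 (x + δ)).hasDerivAt.comp_add_const x δ
  exact (h1.sub (hG.integral_hasStrictDerivAt 0 x).hasDerivAt).const_mul δ⁻¹

lemma hasDerivAt_boxDiff {G G' : ℝ → ℝ} (hG : ∀ x, HasDerivAt G (G' x) x) (δ x : ℝ) :
    HasDerivAt (boxDiff δ G) (boxDiff δ G' x) x :=
  (((hG (x + δ)).comp_add_const x δ).sub (hG x)).const_mul δ⁻¹

lemma continuous_boxAvg {G : ℝ → ℝ} (hG : Continuous G) (δ : ℝ) : Continuous (boxAvg δ G) :=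
  continuous_iff_continuousAt.mpr fun x => (hasDerivAt_boxAvg hG δ x).continuousAt

lemma continuous_boxDiff {G : ℝ → ℝ} (hG : Continuous G) (δ : ℝ) : Continuous (boxDiff δ G) := by
  unfold boxDiff; fun_prop

lemma abs_boxDiff_le {G : ℝ → ℝ} {K δ : ℝ} (hδ : 0 < δ)
    (hG : ∀ x y, |G x - G y| ≤ K * |x - y|) (x : ℝ) : |boxDiff δ G x| ≤ K := by
  have := hG (x + δ) x
  rw [add_sub_cancel_left, abs_of_pos hδ] at this
  rw [boxDiff, abs_mul, abs_of_pos (inv_pos.mpr hδ), inv_mul_le_iff₀ hδ, mul_comm]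
  exact this

lemma abs_boxDiff_le_of_bdd {G : ℝ → ℝ} {M δ : ℝ} (hδ : 0 < δ) (hG : ∀ x, |G x| ≤ M) (x : ℝ) :
    |boxDiff δ G x| ≤ 2 * M / δ := by
  rw [boxDiff, abs_mul, abs_of_pos (inv_pos.mpr hδ), inv_mul_eq_div]
  have := (abs_sub (G (x + δ)) (G x)).trans (add_le_add (hG _) (hG _))
  gcongr
  linarith

lemma abs_boxAvg_le {G : ℝ → ℝ} {M δ : ℝ} (hδ : 0 < δ) (hG : ∀ x, |G x| ≤ M) (x : ℝ) :
    |boxAvg δ G x| ≤ M := by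
  have := intervalIntegral.norm_integral_le_of_norm_le_const (a := x) (b := x + δ) (f := G)
    (C := M) fun t _ => hG t
  rw [add_sub_cancel_left, abs_of_pos hδ, Real.norm_eq_abs] at this
  rw [boxAvg, abs_mul, abs_of_pos (inv_pos.mpr hδ), inv_mul_le_iff₀ hδ, mul_comm]
  exact this

lemma continuous_of_lipschitz {G : ℝ → ℝ} {K : ℝ} (hG : ∀ x y, |G x - G y| ≤ K * |x - y|) :
    Continuous G :=
  (LipschitzWith.of_dist_le' fun x y => by simpa [Real.dist_eq] using hG x y).continuous

lemma lipschitz_boxAvg {G : ℝ → ℝ} {K δ : ℝ} (hδ : 0 < δ)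
    (hG : ∀ x y, |G x - G y| ≤ K * |x - y|) (x y : ℝ) :
    |boxAvg δ G x - boxAvg δ G y| ≤ K * |x - y| :=
  convex_univ.norm_image_sub_le_of_norm_hasDerivWithin_le
    (fun u _ => (hasDerivAt_boxAvg (continuous_of_lipschitz hG) δ u).hasDerivWithinAt)
    (fun u _ => abs_boxDiff_le hδ hG u) (Set.mem_univ y) (Set.mem_univ x)

lemma abs_boxAvg_sub_le {G : ℝ → ℝ} {K δ : ℝ} (hδ : 0 < δ) (hK : 0 ≤ K)
    (hG : ∀ x y, |G x - G y| ≤ K * |x - y|) (x : ℝ) : |boxAvg δ G x - G x| ≤ K * δ := by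
  have := intervalIntegral.norm_integral_le_of_norm_le_const (a := x) (b := x + δ)
    (f := fun t => G t - G x) (C := K * δ) fun t ht => by
      rw [Set.uIoc_of_le (by linarith)] at ht
      refine (hG t x).trans (mul_le_mul_of_nonneg_left ?_ hK)
      rw [abs_of_pos (by linarith [ht.1])]
      linarith [ht.2]
  rw [intervalIntegral.integral_sub ((continuous_of_lipschitz hG).intervalIntegrable _ _)
    intervalIntegrable_const, intervalIntegral.integral_const, add_sub_cancel_left,
    abs_of_pos hδ, Real.norm_eq_abs, smul_eq_mul] at this
  have e : boxAvg δ G x - G x = δ⁻¹ * ((∫ t in x..(x + δ), G t) - δ * G x) := by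
    rw [boxAvg]; field_simp
  rw [e, abs_mul, abs_of_pos (inv_pos.mpr hδ), inv_mul_le_iff₀ hδ]
  exact this.trans_eq (by ring)

/-- A bounded Lipschitz function is uniformly close to one with controlled derivatives. -/
lemma exists_fourthOrder_approx {F : ℝ → ℝ} {K δ : ℝ} (hδ : 0 < δ) (hK : 0 ≤ K)
    (hF : ∀ x y, |F x - F y| ≤ K * |x - y|) (hb : ∀ x, |F x| ≤ 1) :
    ∃ f f₁ f₂ f₃ : ℝ → ℝ,
      FourthOrder f f₁ f₂ f₃ (1 + K) (2 * K / δ) (4 * K / δ ^ 2) (8 * K / δ ^ 3) ∧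
      ∀ x, |f x - F x| ≤ 4 * (K * δ) := by
  set G₁ := boxAvg δ F with h1
  set G₂ := boxAvg δ G₁ with h2
  set G₃ := boxAvg δ G₂ with h3
  have l1 := lipschitz_boxAvg hδ hF
  have l2 := lipschitz_boxAvg hδ l1
  have l3 := lipschitz_boxAvg hδ l2
  have c0 := continuous_of_lipschitz hF
  have c1 := continuous_of_lipschitz l1
  have c2 := continuous_of_lipschitz l2
  have c3 := continuous_of_lipschitz l3
  have d1 := hasDerivAt_boxAvg c0 δ
  have d2 := hasDerivAt_boxAvg c1 δ
  have d3 := hasDerivAt_boxAvg c2 δ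
  have d4 := hasDerivAt_boxAvg c3 δ
  have b2 : ∀ x, |boxDiff δ (boxDiff δ G₂) x| ≤ 2 * K / δ :=
    abs_boxDiff_le_of_bdd hδ (abs_boxDiff_le hδ l2)
  have b3 : ∀ x, |boxDiff δ (boxDiff δ (boxDiff δ G₁)) x| ≤ 4 * K / δ ^ 2 := fun x =>
    (abs_boxDiff_le_of_bdd hδ (abs_boxDiff_le_of_bdd hδ (abs_boxDiff_le hδ l1)) x).trans_eq
      (by field_simp; ring)
  have b4 : ∀ x, |boxDiff δ (boxDiff δ (boxDiff δ (boxDiff δ F))) x| ≤ 8 * K / δ ^ 3 := fun x =>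
    (abs_boxDiff_le_of_bdd hδ (abs_boxDiff_le_of_bdd hδ (abs_boxDiff_le_of_bdd hδ
      (abs_boxDiff_le hδ hF))) x).trans_eq (by field_simp; ring)
  have a0 := abs_boxAvg_le hδ (abs_boxAvg_le hδ (abs_boxAvg_le hδ (abs_boxAvg_le hδ hb)))
  refine ⟨boxAvg δ G₃, boxDiff δ G₃, boxDiff δ (boxDiff δ G₂),
    boxDiff δ (boxDiff δ (boxDiff δ G₁)), ?_, fun x => ?_⟩
  · exact
    { cont := continuous_boxAvg c3 δ
      cont₁ := continuous_boxDiff c3 δ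
      cont₂ := continuous_boxDiff (continuous_boxDiff c2 δ) δ
      cont₃ := continuous_boxDiff (continuous_boxDiff (continuous_boxDiff c1 δ) δ) δ
      bdd := fun x => (a0 x).trans (by linarith)
      bdd₁ := fun x => (abs_boxDiff_le hδ l3 x).trans (by linarith)
      bdd₂ := b2
      bdd₃ := b3
      taylor := abs_taylor_four_le d4 (hasDerivAt_boxDiff d3 δ)
        (hasDerivAt_boxDiff (hasDerivAt_boxDiff d2 δ) δ)
        (hasDerivAt_boxDiff (hasDerivAt_boxDiff (hasDerivAt_boxDiff d1 δ) δ) δ) b4 }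
  · have e1 := abs_le.mp (abs_boxAvg_sub_le hδ hK hF x)
    have e2 := abs_le.mp (abs_boxAvg_sub_le hδ hK l1 x)
    have e3 := abs_le.mp (abs_boxAvg_sub_le hδ hK l2 x)
    have e4 := abs_le.mp (abs_boxAvg_sub_le hδ hK l3 x)
    simp only [← h1, ← h2, ← h3] at e1 e2 e3 e4
    exact abs_le.mpr ⟨by linarith, by linarith⟩

lemma FourthOrder.comp_mul {f f₁ f₂ f₃ : ℝ → ℝ} {B B₂ B₃ B₄ : ℝ}
    (h : FourthOrder f f₁ f₂ f₃ B B₂ B₃ B₄) {l : ℝ} (hl : 0 ≤ l) (hl1 : l ≤ 1) :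
    FourthOrder (fun x => f (l * x)) (fun x => l * f₁ (l * x)) (fun x => l ^ 2 * f₂ (l * x))
      (fun x => l ^ 3 * f₃ (l * x)) B (l ^ 2 * B₂) (l ^ 3 * B₃) (l ^ 4 * B₄) where
  cont := h.cont.comp (continuous_const_mul l)
  cont₁ := continuous_const.mul (h.cont₁.comp (continuous_const_mul l))
  cont₂ := continuous_const.mul (h.cont₂.comp (continuous_const_mul l))
  cont₃ := continuous_const.mul (h.cont₃.comp (continuous_const_mul l))
  bdd x := h.bdd _
  bdd₁ x := by
    rw [abs_mul, abs_of_nonneg hl]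
    nlinarith [h.bdd₁ (l * x), abs_nonneg (f₁ (l * x))]
  bdd₂ x := by
    rw [abs_mul, abs_of_nonneg (by positivity : 0 ≤ l ^ 2)]
    exact mul_le_mul_of_nonneg_left (h.bdd₂ _) (by positivity)
  bdd₃ x := by
    rw [abs_mul, abs_of_nonneg (by positivity : 0 ≤ l ^ 3)]
    exact mul_le_mul_of_nonneg_left (h.bdd₃ _) (by positivity)
  taylor x y := by
    have := h.taylor (l * x) (l * y)
    rw [← mul_add] at this
    convert this using 1
    · congr 1; ring
    · ring

lemma abs_sub_le_of_abs_sq_sub_sq_le {x y e : ℝ} (hx : 0 ≤ x) (hy : 0 ≤ y) (he : 0 ≤ e)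
    (h : |x ^ 2 - y ^ 2| ≤ e ^ 2) : |x - y| ≤ e := by
  refine abs_le_of_sq_le_sq ?_ he
  have h1 : |x - y| * |x - y| ≤ |x - y| * |x + y| := by
    refine mul_le_mul_of_nonneg_left ?_ (abs_nonneg _)
    rw [abs_of_nonneg (add_nonneg hx hy)]
    exact abs_le.mpr ⟨by linarith, by linarith⟩
  rw [abs_mul_abs_self, ← abs_mul, mul_comm (x - y) (x + y), ← sq_sub_sq] at h1
  nlinarith

section LipschitzApprox

open ProbabilityTheory

lemma abs_gaussian_integral_sub_le {f F : ℝ → ℝ} {K A B e s t : ℝ} (hK : 0 ≤ K)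
    (hF : ∀ x y, |F x - F y| ≤ K * |x - y|) (hFb : ∀ x, |F x| ≤ A)
    (hf : Continuous f) (hfb : ∀ x, |f x| ≤ B) (hfF : ∀ x, |f x - F x| ≤ e) :
    |∫ z, f (s * z) ∂gaussianReal 0 1 - ∫ z, F (t * z) ∂gaussianReal 0 1| ≤
      e + 2 * (K * |s - t|) := by
  have cF := continuous_of_lipschitz hF
  have i1 : Integrable (fun z => f (s * z)) (gaussianReal 0 1) :=
    integrable_of_continuous_of_bdd (by fun_prop) (fun z => hfb _) _
  have i2 : Integrable (fun z => F (t * z)) (gaussianReal 0 1) :=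
    integrable_of_continuous_of_bdd (by fun_prop) (fun z => hFb _) _
  have i3 : Integrable (fun z : ℝ => (e + K * |s - t|) + K * |s - t| * z ^ 2)
      (gaussianReal 0 1) :=
    (integrable_const _).add ((integrable_pow_gaussianReal 1 2).const_mul _)
  rw [← integral_sub i1 i2]
  have hp : ∀ z : ℝ, ‖f (s * z) - F (t * z)‖ ≤ (e + K * |s - t|) + K * |s - t| * z ^ 2 := by
    intro z
    rw [Real.norm_eq_abs]
    have h1 := hF (s * z) (t * z)
    rw [← sub_mul, abs_mul, ← mul_assoc] at h1
    have h2 : |z| ≤ 1 + z ^ 2 := by nlinarith [sq_abs z, sq_nonneg (|z| - 1)]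
    have h3 := mul_le_mul_of_nonneg_left h2 (mul_nonneg hK (abs_nonneg (s - t)))
    have h4 := abs_sub_le (f (s * z)) (F (s * z)) (F (t * z))
    have h5 := hfF (s * z)
    linarith
  have h := norm_integral_le_of_norm_le i3 (ae_of_all _ hp)
  rw [integral_add (integrable_const _) ((integrable_pow_gaussianReal 1 2).const_mul _),
    integral_const_mul, integral_sq_gaussianReal, Real.norm_eq_abs] at h
  simp only [integral_const, probReal_univ, one_smul, NNReal.coe_one, mul_one] at h
  linarith

/-- Gaussian approximation of the number of rising sequences, for Lipschitz test functions. -/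
lemma abs_uniformMean_lipschitz_sub_le {F : ℝ → ℝ} {K : ℝ} (hK : 0 ≤ K)
    (hF : ∀ x y, |F x - F y| ≤ K * |x - y|) (hFb : ∀ x, |F x| ≤ 1) {n : ℕ} {b : ℝ}
    (hb : 1 ≤ b) (hn : (n : ℝ) + 1 = b ^ 4) :
    |uniformMean (n + 1) (fun r => F ((r - ((n : ℝ) + 2) / 2) / b ^ 2)) -
      ∫ z, F z ∂gaussianReal 0 (1 / 12)| ≤ (28 + 8 * gaussFourth) * K / b := by
  have hb0 : 0 < b := by linarith
  obtain ⟨f, f₁, f₂, f₃, hf, hfF⟩ := exists_fourthOrder_approx (inv_pos.mpr hb0) hK hF hFb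
  have hl1 : (b ^ 6)⁻¹ ≤ 1 := inv_le_one_of_one_le₀ (one_le_pow₀ hb)
  have L := abs_uniformMean_sub_gaussian_le (N := b ^ 4) (q := b ^ 2) (by positivity) n hn.le
    (hf.comp_mul (l := (b ^ 6)⁻¹) (by positivity) hl1)
  have earg : ∀ r : ℕ, (b ^ 6)⁻¹ * (((n : ℝ) + 1) * (r - ((n : ℝ) + 2) / 2)) =
      (r - ((n : ℝ) + 2) / 2) / b ^ 2 := fun r => by
    rw [hn]; field_simp
  simp only [earg] at L
  have S := abs_uniformMean_sub_le (n := n + 1) (by omega)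
    (φ := fun r => F ((r - ((n : ℝ) + 2) / 2) / b ^ 2))
    (ψ := fun r => f ((r - ((n : ℝ) + 2) / 2) / b ^ 2)) (χ := fun _ => 4 * (K * b⁻¹))
    (fun r _ _ => by rw [abs_sub_comm]; exact hfF _)
  rw [uniformMean_const] at S
  have cf := hf.cont
  rw [integral_gaussianReal_eq_sqrt (f := fun z => f ((b ^ 6)⁻¹ * z)) (by fun_prop)] at L
  have eI : ∫ z, f ((b ^ 6)⁻¹ * (√(lindebergVar n : ℝ) * z)) ∂gaussianReal 0 1 =
      ∫ z, f ((b ^ 6)⁻¹ * √(lindebergVar n : ℝ) * z) ∂gaussianReal 0 1 := by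
    simp only [mul_assoc]
  rw [eI] at L
  have G := abs_gaussian_integral_sub_le (s := (b ^ 6)⁻¹ * √(lindebergVar n : ℝ))
    (t := √((1 / 12 : ℝ≥0) : ℝ)) hK hF hFb hf.cont hf.bdd hfF
  rw [← integral_gaussianReal_eq_sqrt (continuous_of_lipschitz hF)] at G
  have hn1 : (1 : ℝ) ≤ b ^ 4 := one_le_pow₀ hb
  have V : |(b ^ 6)⁻¹ * √(lindebergVar n : ℝ) - √((1 / 12 : ℝ≥0) : ℝ)| ≤ b⁻¹ := by
    refine abs_sub_le_of_abs_sq_sub_sq_le (by positivity) (by positivity) (by positivity) ?_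
    rw [mul_pow, Real.sq_sqrt (by positivity), Real.sq_sqrt (by positivity), coe_lindebergVar]
    have e : ((b ^ 6)⁻¹) ^ 2 * ((((n : ℝ) + 1) * (n + 2) * (2 * n + 3) / 6 - 1) / 4) -
        ((1 / 12 : ℝ≥0) : ℝ) = (3 * (b ^ 4) ^ 2 + b ^ 4 - 6) / (24 * (b ^ 4) ^ 3) := by
      have : (n : ℝ) = b ^ 4 - 1 := by linarith
      rw [this]
      push_cast
      field_simp
      ring
    rw [e, abs_div, abs_of_pos (by positivity : 0 < 24 * (b ^ 4) ^ 3), div_le_iff₀ (by positivity)]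
    have e2 : (b⁻¹) ^ 2 * (24 * (b ^ 4) ^ 3) = 24 * b ^ 2 * (b ^ 4) ^ 2 := by field_simp
    rw [e2]
    have h2 : 1 ≤ b ^ 2 := one_le_pow₀ hb
    have h3 : (b ^ 4) ^ 2 ≤ b ^ 2 * (b ^ 4) ^ 2 := le_mul_of_one_le_left (by positivity) h2
    have h4 : b ^ 4 ≤ (b ^ 4) ^ 2 := by nlinarith
    exact abs_le.mpr ⟨by linarith, by linarith⟩
  have hM := gaussFourth_nonneg
  have E : (n : ℝ) * (((b ^ 6)⁻¹) ^ 2 * (2 * K / b⁻¹) * b ^ 4 +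
      ((b ^ 6)⁻¹) ^ 3 * (4 * K / b⁻¹ ^ 2) * ((b ^ 4) ^ 2 * (b ^ 4 / b ^ 2 + b ^ 2)) +
      ((b ^ 6)⁻¹) ^ 4 * (8 * K / b⁻¹ ^ 3) * ((1 + gaussFourth) * (b ^ 4) ^ 4)) ≤
      (18 + 8 * gaussFourth) * K / b := by
    refine (mul_le_mul_of_nonneg_right (by linarith : (n : ℝ) ≤ b ^ 4)
      (by positivity)).trans ?_
    have e : b ^ 4 * (((b ^ 6)⁻¹) ^ 2 * (2 * K / b⁻¹) * b ^ 4 +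
      ((b ^ 6)⁻¹) ^ 3 * (4 * K / b⁻¹ ^ 2) * ((b ^ 4) ^ 2 * (b ^ 4 / b ^ 2 + b ^ 2)) +
      ((b ^ 6)⁻¹) ^ 4 * (8 * K / b⁻¹ ^ 3) * ((1 + gaussFourth) * (b ^ 4) ^ 4)) =
      (2 * K * (b⁻¹) ^ 2 + 8 * K * b⁻¹ + 8 * (1 + gaussFourth) * K) / b := by
      field_simp
      ring
    rw [e]
    have i1 : b⁻¹ ≤ 1 := inv_le_one_of_one_le₀ hb
    have i2 : (b⁻¹) ^ 2 ≤ 1 := pow_le_one₀ (by positivity) i1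
    gcongr
    nlinarith
  have T := (abs_sub_le _ _ _).trans (add_le_add S ((abs_sub_le _ _ _).trans
    (add_le_add (L.trans E) G)))
  refine T.trans ?_
  have hV := mul_le_mul_of_nonneg_left V hK
  have e : (28 + 8 * gaussFourth) * K / b = 4 * (K * b⁻¹) + ((18 + 8 * gaussFourth) * K / b +
    (4 * (K * b⁻¹) + 2 * (K * b⁻¹))) := by field_simp; ring
  rw [e]
  linarith

end LipschitzApprox

/-! ### The limiting discrepancy -/

section LimitingDiscrepancy

open ProbabilityTheory

/-- The positive part of `1 - exp (-(s * x + s ^ 2 / 24))`. -/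
def shiftGap (s x : ℝ) : ℝ := 1 - Real.exp (-max (s * x + s ^ 2 / 24) 0)

lemma exp_neg_sub_exp_neg_le {p q : ℝ} (hp : 0 ≤ p) (hpq : p ≤ q) :
    Real.exp (-p) - Real.exp (-q) ≤ q - p := by
  have h1 : Real.exp (-q) = Real.exp (-p) * Real.exp (-(q - p)) := by
    rw [← Real.exp_add]; ring_nf
  have h2 := Real.add_one_le_exp (-(q - p))
  have h3 : Real.exp (-p) ≤ 1 := Real.exp_le_one_iff.mpr (by linarith)
  have h4 := Real.exp_pos (-p)
  rw [h1]
  nlinarith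

lemma abs_exp_neg_sub_exp_neg_le {p q : ℝ} (hp : 0 ≤ p) (hq : 0 ≤ q) :
    |Real.exp (-p) - Real.exp (-q)| ≤ |p - q| := by
  wlog h : p ≤ q generalizing p q
  · rw [abs_sub_comm, abs_sub_comm p]
    exact this hq hp (le_of_not_ge h)
  rw [abs_sub_comm p, abs_of_nonneg (sub_nonneg.mpr h), abs_of_nonneg
    (sub_nonneg.mpr (Real.exp_le_exp.mpr (by linarith)))]
  exact exp_neg_sub_exp_neg_le hp h

lemma abs_shiftGap_sub_le {s : ℝ} (hs : 0 ≤ s) (x y : ℝ) :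
    |shiftGap s x - shiftGap s y| ≤ s * |x - y| := by
  rw [shiftGap, shiftGap, sub_sub_sub_cancel_left, abs_sub_comm]
  refine (abs_exp_neg_sub_exp_neg_le (le_max_right _ _) (le_max_right _ _)).trans ?_
  refine (abs_max_sub_max_le_abs _ _ _).trans_eq ?_
  rw [add_sub_add_right_eq_sub, ← mul_sub, abs_mul, abs_of_nonneg hs]

lemma shiftGap_nonneg (s x : ℝ) : 0 ≤ shiftGap s x :=
  sub_nonneg.mpr (Real.exp_le_one_iff.mpr (neg_nonpos.mpr (le_max_right _ _)))

lemma shiftGap_le_one (s x : ℝ) : shiftGap s x ≤ 1 :=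
  sub_le_self _ (Real.exp_pos _).le

lemma shiftGap_le (s x : ℝ) : shiftGap s x ≤ max (s * x + s ^ 2 / 24) 0 := by
  have := Real.add_one_le_exp (-max (s * x + s ^ 2 / 24) 0)
  rw [shiftGap]
  linarith

lemma gaussianPDFReal_twelfth (x : ℝ) :
    gaussianPDFReal 0 (1 / 12) x =
      √12 * ((√(2 * Real.pi))⁻¹ * Real.exp (-(√12 * x) ^ 2 / 2)) := by
  rw [gaussianPDFReal]
  have e : √(2 * Real.pi * ((1 / 12 : ℝ≥0) : ℝ)) = √(2 * Real.pi) / √12 := by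
    rw [← Real.sqrt_div (by positivity)]
    congr 1
    push_cast
    ring
  have e2 : -(x - 0) ^ 2 / (2 * ((1 / 12 : ℝ≥0) : ℝ)) = -(√12 * x) ^ 2 / 2 := by
    rw [mul_pow, Real.sq_sqrt (by norm_num)]
    push_cast
    ring
  rw [e, e2, inv_div, div_eq_mul_inv, mul_assoc]

lemma integral_gaussianPDFReal_twelfth (s : ℝ) :
    ∫ x in (-(s / 24))..(s / 24), gaussianPDFReal 0 (1 / 12) x = Psi s := by
  have h : √12 * (s / 24) = s / (4 * √3) := by
    have : √12 = 2 * √3 := by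
      rw [show (12 : ℝ) = 2 ^ 2 * 3 by norm_num, Real.sqrt_mul (by norm_num),
        Real.sqrt_sq (by norm_num)]
    rw [this]
    have h3 : √3 ^ 2 = 3 := Real.sq_sqrt (by norm_num)
    field_simp
    rw [h3]
    ring
  simp only [gaussianPDFReal_twelfth]
  rw [intervalIntegral.integral_const_mul,
    intervalIntegral.mul_integral_comp_mul_left
      (f := fun t => (√(2 * Real.pi))⁻¹ * Real.exp (-t ^ 2 / 2)),
    intervalIntegral.integral_const_mul, mul_neg, h, Psi]

lemma gaussianPDFReal_twelfth_mul_exp (s x : ℝ) :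
    gaussianPDFReal 0 (1 / 12) x * Real.exp (-(s * x + s ^ 2 / 24)) =
      gaussianPDFReal 0 (1 / 12) (x + s / 12) := by
  rw [gaussianPDFReal, gaussianPDFReal, mul_assoc, ← Real.exp_add]
  congr 2
  push_cast
  ring

lemma gaussianPDFReal_mul_shiftGap {s : ℝ} (hs : 0 < s) (x : ℝ) :
    gaussianPDFReal 0 (1 / 12) x * shiftGap s x =
      (Set.Ioi (-(s / 24))).indicator (gaussianPDFReal 0 (1 / 12)) x -
        (Set.Ioi (s / 24)).indicator (gaussianPDFReal 0 (1 / 12)) (x + s / 12) := by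
  have hx : s * x + s ^ 2 / 24 = s * (x + s / 24) := by ring
  by_cases h : -(s / 24) < x
  · rw [Set.indicator_of_mem (Set.mem_Ioi.mpr h),
      Set.indicator_of_mem (Set.mem_Ioi.mpr (by linarith)), shiftGap, max_eq_left,
      mul_sub, mul_one, gaussianPDFReal_twelfth_mul_exp]
    rw [hx]
    exact mul_nonneg hs.le (by linarith)
  · rw [Set.indicator_of_notMem (by simpa using h),
      Set.indicator_of_notMem (by rw [Set.mem_Ioi]; linarith), shiftGap, max_eq_right]
    · simp
    · rw [hx]
      exact mul_nonpos_of_nonneg_of_nonpos hs.le (by linarith)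

lemma integral_shiftGap {s : ℝ} (hs : 0 < s) :
    ∫ x, shiftGap s x ∂gaussianReal 0 (1 / 12) = Psi s := by
  have hI : ∀ y : ℝ, Integrable ((Set.Ioi y).indicator (gaussianPDFReal 0 (1 / 12))) :=
    fun y => (integrable_gaussianPDFReal _ _).indicator measurableSet_Ioi
  rw [integral_gaussianReal_eq_integral_smul (by norm_num)]
  simp only [smul_eq_mul, gaussianPDFReal_mul_shiftGap hs]
  rw [integral_sub (hI _) ((hI _).comp_add_right _),
    integral_add_right_eq_self ((Set.Ioi (s / 24)).indicator (gaussianPDFReal 0 (1 / 12))),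
    integral_indicator measurableSet_Ioi, integral_indicator measurableSet_Ioi,
    intervalIntegral.integral_Ioi_sub_Ioi (integrable_gaussianPDFReal _ _).integrableOn
      (by linarith), integral_gaussianPDFReal_twelfth]

end LimitingDiscrepancy

/-! ### The likelihood ratio of a shuffle -/

/-- The likelihood ratio of the `m`-shuffle at a permutation with `r` rising sequences. -/
def likelihood (n m r : ℕ) : ℝ :=
  (n.factorial : ℝ) * (((m : ℝ) ^ n)⁻¹ * (Nat.choose (n + m - r) n : ℝ))

lemma likelihood_eq_prod {n m r : ℕ} (hr : r ≤ n) (hnm : n ≤ m) (hm : 0 < m) :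
    likelihood n m r = ∏ i ∈ Finset.range n, (1 + ((n : ℝ) - r - i) / m) := by
  have hm' : (m : ℝ) ≠ 0 := by positivity
  have h1 : (n.factorial : ℝ) * (Nat.choose (n + m - r) n : ℝ) =
      ∏ i ∈ Finset.range n, ((m : ℝ) + (n - r - i)) := by
    rw [← Nat.cast_mul, ← Nat.descFactorial_eq_factorial_mul_choose,
      Nat.descFactorial_eq_prod_range, Nat.cast_prod]
    refine Finset.prod_congr rfl fun i hi => ?_
    have := Finset.mem_range.mp hi
    rw [Nat.cast_sub (by omega), Nat.cast_sub (by omega)]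
    push_cast
    ring
  have h2 : ((m : ℝ) ^ n)⁻¹ = ∏ i ∈ Finset.range n, (m : ℝ)⁻¹ := by simp
  rw [likelihood, mul_left_comm, h1, h2, ← Finset.prod_mul_distrib]
  refine Finset.prod_congr rfl fun i _ => ?_
  field_simp

lemma abs_log_prod_one_add_sub_le {n : ℕ} {b : ℕ → ℝ} {β : ℝ} (hβ : β ≤ 1 / 2)
    (hb : ∀ i ∈ Finset.range n, |b i| ≤ β) :
    |Real.log (∏ i ∈ Finset.range n, (1 + b i)) -
      (∑ i ∈ Finset.range n, b i - (∑ i ∈ Finset.range n, b i ^ 2) / 2)| ≤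
      n * (2 * β ^ 3) := by
  have hpos : ∀ i ∈ Finset.range n, 1 + b i ≠ 0 := fun i hi => by
    have := (abs_le.mp (hb i hi)).1
    linarith
  rw [Real.log_prod hpos, Finset.sum_div, ← Finset.sum_sub_distrib, ← Finset.sum_sub_distrib]
  refine (Finset.abs_sum_le_sum_abs _ _).trans ?_
  have : ∀ i ∈ Finset.range n, |Real.log (1 + b i) - (b i - b i ^ 2 / 2)| ≤ 2 * β ^ 3 := by
    intro i hi
    have h := hb i hi
    have h0 := abs_nonneg (b i)
    have key := Real.abs_log_sub_add_sum_range_le (x := -b i) (by rw [abs_neg]; linarith) 2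
    rw [Finset.sum_range_succ, Finset.sum_range_one, abs_neg, sub_neg_eq_add] at key
    have e : Real.log (1 + b i) - (b i - b i ^ 2 / 2) =
        (-b i) ^ (0 + 1) / (((0 : ℕ) : ℝ) + 1) + (-b i) ^ (1 + 1) / (((1 : ℕ) : ℝ) + 1) +
          Real.log (1 + b i) := by
      push_cast
      ring
    rw [e]
    refine key.trans ?_
    rw [div_le_iff₀ (by linarith)]
    have h3 : |b i| ^ (2 + 1) ≤ β ^ 3 := pow_le_pow_left₀ h0 h 3
    have h4 : 0 ≤ β ^ 3 := (pow_nonneg h0 _).trans h3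
    nlinarith
  exact (Finset.sum_le_sum this).trans_eq (by simp)

lemma sum_range_sub_cast (n : ℕ) (y : ℝ) :
    ∑ i ∈ Finset.range n, (y - i) = n * (y - ((n : ℝ) - 1) / 2) := by
  induction n with
  | zero => simp
  | succ k ih => rw [Finset.sum_range_succ, ih]; push_cast; ring

lemma sum_range_sub_cast_sq (n : ℕ) (y : ℝ) :
    ∑ i ∈ Finset.range n, (y - i) ^ 2 =
      n * (y - ((n : ℝ) - 1) / 2) ^ 2 + n * ((n : ℝ) ^ 2 - 1) / 12 := by
  induction n with
  | zero => simp
  | succ k ih => rw [Finset.sum_range_succ, ih]; push_cast; ring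

lemma abs_exp_sub_one_le_mul_exp (y : ℝ) : |Real.exp y - 1| ≤ |y| * Real.exp |y| := by
  rcases le_total 0 y with h | h
  · rw [abs_of_nonneg h, abs_of_nonneg (by linarith [Real.one_le_exp h])]
    have := exp_neg_sub_exp_neg_le le_rfl h
    have h2 := Real.exp_pos y
    have h3 : Real.exp (-y) * Real.exp y = 1 := by rw [← Real.exp_add]; simp
    rw [neg_zero, Real.exp_zero] at this
    nlinarith
  · rw [abs_of_nonpos h, abs_sub_comm, abs_of_nonneg (by linarith [Real.exp_le_one_iff.mpr h])]
    have := Real.add_one_le_exp y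
    have h2 := Real.one_le_exp (neg_nonneg.mpr h)
    nlinarith

section Expansion

variable {s q : ℝ} {n m r : ℕ}

/-- The error in the Gaussian approximation of the likelihood ratio. -/
def likelihoodErr (s q x : ℝ) : ℝ := (s ^ 2 * (x ^ 2 + 1) + 2 * s ^ 3) / q ^ 2

lemma log_likelihood_expansion (hq : 1 ≤ q) (hn : (n : ℝ) = q ^ 4) (hm : (m : ℝ) * s = q ^ 6)
    (hs : 0 < s) (hsq : 2 * s ≤ q ^ 2) (hr1 : 1 ≤ r) (hr : r ≤ n) :
    ∃ ρ : ℝ, |ρ| ≤ likelihoodErr s q ((r - ((n : ℝ) + 1) / 2) / q ^ 2) ∧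
      |ρ| ≤ s ^ 2 + 2 * s ^ 3 ∧
      likelihood n m r =
        Real.exp (-(s * ((r - ((n : ℝ) + 1) / 2) / q ^ 2) + s ^ 2 / 24) + ρ) := by
  have hq0 : 0 < q := by linarith
  have hmv : (m : ℝ) = q ^ 6 / s := by rw [← hm]; field_simp
  have hm0 : (0 : ℝ) < m := by rw [hmv]; positivity
  have hnm : (n : ℝ) ≤ m := by
    rw [hmv, le_div_iff₀ hs, hn]
    have : 0 < q ^ 4 := by positivity
    nlinarith
  have hr1' : (1 : ℝ) ≤ r := by exact_mod_cast hr1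
  have hr' : (r : ℝ) ≤ n := by exact_mod_cast hr
  have hβ : s / q ^ 2 ≤ 1 / 2 := by rw [div_le_iff₀ (by positivity)]; linarith
  have hb : ∀ i ∈ Finset.range n, |((n : ℝ) - r - i) / m| ≤ s / q ^ 2 := by
    intro i hi
    have hi' : (i : ℝ) + 1 ≤ n := by exact_mod_cast Finset.mem_range.mp hi
    have hi0 : (0 : ℝ) ≤ i := by positivity
    have e : s / q ^ 2 = n / m := by rw [hmv, hn]; field_simp
    rw [e, abs_div, abs_of_pos hm0]
    gcongr
    exact abs_le.mpr ⟨by linarith, by linarith⟩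
  have L := abs_log_prod_one_add_sub_le hβ hb
  rw [← likelihood_eq_prod hr (by exact_mod_cast hnm) (by exact_mod_cast hm0)] at L
  have hpos : 0 < likelihood n m r := by
    rw [likelihood_eq_prod hr (by exact_mod_cast hnm) (by exact_mod_cast hm0)]
    refine Finset.prod_pos fun i hi => ?_
    have := (abs_le.mp (hb i hi)).1
    linarith
  set x := (r - ((n : ℝ) + 1) / 2) / q ^ 2 with hx
  have hD : (r : ℝ) - ((n : ℝ) + 1) / 2 = x * q ^ 2 := by rw [hx]; field_simp
  have S1 : ∑ i ∈ Finset.range n, ((n : ℝ) - r - i) / m = -(s * x) := by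
    rw [← Finset.sum_div, sum_range_sub_cast]
    have : (n : ℝ) - r - ((n : ℝ) - 1) / 2 = -(x * q ^ 2) := by rw [← hD]; ring
    rw [this, hmv, hn]
    field_simp
  have S2 : ∑ i ∈ Finset.range n, (((n : ℝ) - r - i) / m) ^ 2 =
      s ^ 2 * x ^ 2 / q ^ 4 + s ^ 2 / 12 - s ^ 2 / (12 * q ^ 8) := by
    simp only [div_pow]
    rw [← Finset.sum_div, sum_range_sub_cast_sq]
    have : (n : ℝ) - r - ((n : ℝ) - 1) / 2 = -(x * q ^ 2) := by rw [← hD]; ring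
    rw [this, hmv, hn]
    field_simp
    ring
  rw [S1, S2] at L
  have e3 : (n : ℝ) * (2 * (s / q ^ 2) ^ 3) = 2 * s ^ 3 / q ^ 2 := by
    rw [hn]; field_simp
  rw [e3] at L
  have hx1 : x ^ 2 / q ^ 4 ≤ 1 := by
    have : x ^ 2 / q ^ 4 = ((r - ((n : ℝ) + 1) / 2) / n) ^ 2 := by rw [hn, hx, hn]; field_simp
    rw [this, sq_le_one_iff_abs_le_one, abs_div, div_le_one (by rw [abs_pos]; linarith)]
    rw [abs_of_nonneg (by linarith : (0 : ℝ) ≤ n)]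
    exact abs_le.mpr ⟨by linarith, by linarith⟩
  have hq2 : 1 ≤ q ^ 2 := one_le_pow₀ hq
  have hL := abs_le.mp L
  have p1 : 0 ≤ s ^ 2 * x ^ 2 / q ^ 4 := by positivity
  have p2 : 0 ≤ s ^ 2 / (12 * q ^ 8) := by positivity
  refine ⟨Real.log (likelihood n m r) - -(s * x + s ^ 2 / 24), ?_, ?_, ?_⟩
  · have p3 : s ^ 2 * x ^ 2 / q ^ 4 ≤ s ^ 2 * x ^ 2 / q ^ 2 := by
      gcongr
      norm_num
    have p4 : s ^ 2 / (12 * q ^ 8) ≤ s ^ 2 / q ^ 2 := by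
      gcongr
      nlinarith [pow_le_pow_right₀ hq (by norm_num : 2 ≤ 8)]
    have e : likelihoodErr s q x = s ^ 2 * x ^ 2 / q ^ 2 + s ^ 2 / q ^ 2 + 2 * s ^ 3 / q ^ 2 := by
      rw [likelihoodErr]; ring
    rw [e]
    exact abs_le.mpr ⟨by linarith, by linarith⟩
  · have p3 : s ^ 2 * x ^ 2 / q ^ 4 ≤ s ^ 2 := by
      rw [mul_div_assoc]
      exact mul_le_of_le_one_right (by positivity) hx1
    have p4 : s ^ 2 / (12 * q ^ 8) ≤ s ^ 2 := by
      refine div_le_self (by positivity) ?_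
      nlinarith [one_le_pow₀ hq (n := 8)]
    have p5 : 2 * s ^ 3 / q ^ 2 ≤ 2 * s ^ 3 := div_le_self (by positivity) hq2
    exact abs_le.mpr ⟨by linarith, by linarith⟩
  · rw [add_sub_cancel, Real.exp_log hpos]

lemma abs_truncated_sub_shiftGap_le (hq : 1 ≤ q) (hn : (n : ℝ) = q ^ 4)
    (hm : (m : ℝ) * s = q ^ 6) (hs : 0 < s) (hsq : 2 * s ≤ q ^ 2) (hr1 : 1 ≤ r) (hr : r ≤ n) :
    |(if (n : ℝ) / 2 - s * q ^ 2 / 24 + q ≤ r then 1 - likelihood n m r else 0) -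
      shiftGap s ((r - ((n : ℝ) + 1) / 2) / q ^ 2)| ≤
      s / q + likelihoodErr s q ((r - ((n : ℝ) + 1) / 2) / q ^ 2) *
        Real.exp (s ^ 2 + 2 * s ^ 3) := by
  have hq0 : 0 < q := by linarith
  obtain ⟨ρ, h1, h2, h3⟩ := log_likelihood_expansion hq hn hm hs hsq hr1 hr
  set x := (r - ((n : ℝ) + 1) / 2) / q ^ 2 with hx
  have hD : (r : ℝ) - ((n : ℝ) + 1) / 2 = x * q ^ 2 := by rw [hx]; field_simp
  have hE : 0 ≤ likelihoodErr s q x := (abs_nonneg _).trans h1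
  have hsx : s * x + s ^ 2 / 24 = s * (x + s / 24) := by ring
  split_ifs with h
  · have hx0 : 0 ≤ s * x + s ^ 2 / 24 := by
      rw [hsx]
      refine mul_nonneg hs.le ?_
      have : 0 ≤ (x + s / 24) * q ^ 2 := by linarith
      exact nonneg_of_mul_nonneg_left this (by positivity)
    rw [shiftGap, max_eq_left hx0, sub_sub_sub_cancel_left, h3, Real.exp_add, ← mul_one_sub,
      abs_mul, abs_of_pos (Real.exp_pos _), abs_sub_comm]
    have e1 : Real.exp (-(s * x + s ^ 2 / 24)) ≤ 1 := Real.exp_le_one_iff.mpr (by linarith)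
    have e2 := abs_exp_sub_one_le_mul_exp ρ
    have e3 : |ρ| * Real.exp |ρ| ≤ likelihoodErr s q x * Real.exp (s ^ 2 + 2 * s ^ 3) := by
      gcongr
    have e4 := mul_le_of_le_one_left (abs_nonneg (Real.exp ρ - 1)) e1
    have : 0 ≤ s / q := by positivity
    linarith
  · rw [zero_sub, abs_neg, abs_of_nonneg (shiftGap_nonneg _ _)]
    have hx1 : s * x + s ^ 2 / 24 ≤ s / q := by
      rw [hsx, div_eq_mul_inv]
      refine mul_le_mul_of_nonneg_left ?_ hs.le
      have : (x + s / 24) * q ^ 2 ≤ q⁻¹ * q ^ 2 := by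
        have : q⁻¹ * q ^ 2 = q := by field_simp
        linarith
      exact le_of_mul_le_mul_right this (by positivity)
    have := (shiftGap_le s x).trans (max_le hx1 (by positivity))
    have : 0 ≤ likelihoodErr s q x * Real.exp (s ^ 2 + 2 * s ^ 3) := by positivity
    linarith

end Expansion

/-! ### The discrepancy on `B_c` -/

lemma sum_Us_sub_sum_Qs (n m : ℕ) (T : ℝ) {B : Finset (Equiv.Perm (Fin n))}
    (hB : ∀ σ, σ ∈ B ↔ T ≤ (rSeq n σ : ℝ)) :
    (∑ σ ∈ B, Us n σ) - ∑ σ ∈ B, Qs n m σ =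
      uniformMean n (fun r => if T ≤ (r : ℝ) then 1 - likelihood n m r else 0) := by
  have hf : (n.factorial : ℝ) ≠ 0 := by positivity
  rw [← Finset.sum_sub_distrib, uniformMean, ← Finset.sum_subset (Finset.subset_univ B)]
  · refine Finset.sum_congr rfl fun σ hσ => ?_
    rw [if_pos ((hB σ).mp hσ), Us, Qs, likelihood]
    field_simp
  · intro σ _ hσ
    rw [if_neg (mt (hB σ).mpr hσ), mul_zero]

lemma abs_uniformMean_truncated_sub_Psi_le {s q : ℝ} {n m : ℕ} (hq : 1 ≤ q)
    (hn : (n : ℝ) = q ^ 4) (hm : (m : ℝ) * s = q ^ 6) (hs : 0 < s) (hsq : 2 * s ≤ q ^ 2) :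
    |uniformMean n (fun r => if (n : ℝ) / 2 - s * q ^ 2 / 24 + q ≤ (r : ℝ) then
        1 - likelihood n m r else 0) - Psi s| ≤
      (s + (2 * s ^ 2 + 2 * s ^ 3) * Real.exp (s ^ 2 + 2 * s ^ 3) +
        (28 + 8 * gaussFourth) * s) / q := by
  have hq0 : 0 < q := by linarith
  have hn1 : 1 ≤ n := by
    have : (1 : ℝ) ≤ n := hn ▸ one_le_pow₀ hq
    exact_mod_cast this
  obtain ⟨k, rfl⟩ : ∃ k, n = k + 1 := ⟨n - 1, by omega⟩
  have hk : (k : ℝ) + 1 = q ^ 4 := by rw [← hn]; push_cast; ring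
  set E := Real.exp (s ^ 2 + 2 * s ^ 3) with hE
  have hE0 : 0 < E := Real.exp_pos _
  have G := abs_uniformMean_lipschitz_sub_le hs.le (abs_shiftGap_sub_le hs.le)
    (fun x => abs_le.mpr ⟨by linarith [shiftGap_nonneg s x], shiftGap_le_one s x⟩) hq hk
  rw [integral_shiftGap hs] at G
  have P := abs_uniformMean_sub_le hn1 (fun r hr1 hr =>
    abs_truncated_sub_shiftGap_le hq hn hm hs hsq hr1 hr)
  have eN : (((k + 1 : ℕ) : ℝ) + 1) / 2 = ((k : ℝ) + 2) / 2 := by push_cast; ring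
  simp only [eN] at P
  have M : uniformMean (k + 1) (fun r => s / q +
      likelihoodErr s q ((r - ((k : ℝ) + 2) / 2) / q ^ 2) * E) ≤
      (s + (2 * s ^ 2 + 2 * s ^ 3) * E) / q := by
    have e : (fun r : ℕ => s / q + likelihoodErr s q ((r - ((k : ℝ) + 2) / 2) / q ^ 2) * E) =
        fun r : ℕ => (s / q + (s ^ 2 + 2 * s ^ 3) * E / q ^ 2) +
          (s ^ 2 * E / q ^ 6) * ((r : ℝ) - ((k : ℝ) + 2) / 2) ^ 2 := by
      funext r
      rw [likelihoodErr]
      field_simp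
      ring
    rw [e, uniformMean_add, uniformMean_const, uniformMean_const_mul]
    have V := mul_le_mul_of_nonneg_left (uniformMean_sq_le k)
      (by positivity : 0 ≤ s ^ 2 * E / q ^ 6)
    have V2 : s ^ 2 * E / q ^ 6 * (((k : ℝ) + 2) / 12) ≤ s ^ 2 * E / q ^ 6 * q ^ 4 := by
      refine mul_le_mul_of_nonneg_left ?_ (by positivity)
      have : 0 ≤ (k : ℝ) := by positivity
      linarith
    have V3 : s ^ 2 * E / q ^ 6 * q ^ 4 = s ^ 2 * E / q ^ 2 := by field_simp
    have V4 : (2 * s ^ 2 + 2 * s ^ 3) * E / q ^ 2 ≤ (2 * s ^ 2 + 2 * s ^ 3) * E / q := by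
      gcongr
      nlinarith
    have e2 : (2 * s ^ 2 + 2 * s ^ 3) * E / q ^ 2 =
        (s ^ 2 + 2 * s ^ 3) * E / q ^ 2 + s ^ 2 * E / q ^ 2 := by ring
    rw [add_div s]
    linarith
  have T := (abs_sub_le _ _ _).trans (add_le_add (P.trans M) G)
  refine T.trans_eq ?_
  rw [mul_div_right_comm, add_div]
  ring

lemma mem_Bset_iff {n m : ℕ} (hn : 1 ≤ n) (σ : Equiv.Perm (Fin n)) :
    σ ∈ Bset n m ↔
      (n : ℝ) / 2 - Real.sqrt n / (24 * ((m : ℝ) * (n : ℝ) ^ (-(3 / 2) : ℝ))) +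
        (n : ℝ) ^ ((1 : ℝ) / 4) ≤ (rSeq n σ : ℝ) := by
  simp [Bset, rSeq_le hn]

lemma inf'_discrepancy_eq {n m : ℕ} (hn : 1 ≤ n) (hm : 1 ≤ m) {T : ℝ}
    {B : Finset (Equiv.Perm (Fin n))} (hB : ∀ σ, σ ∈ B ↔ T ≤ (rSeq n σ : ℝ)) :
    (Finset.Icc 1 m).inf' (Finset.nonempty_Icc.mpr hm)
      (fun k => (∑ σ ∈ B, Us n σ) - ∑ σ ∈ B, Qs n k σ) =
      (∑ σ ∈ B, Us n σ) - ∑ σ ∈ B, Qs n m σ := by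
  refine le_antisymm (Finset.inf'_le _ (Finset.mem_Icc.mpr ⟨hm, le_rfl⟩)) ?_
  refine Finset.le_inf' _ _ fun k hk => ?_
  obtain ⟨hk1, hkm⟩ := Finset.mem_Icc.mp hk
  refine sub_le_sub_left (sum_Qs_mono hn hk1 hkm fun σ hσ τ hτ => ?_) _
  rw [hB] at hσ hτ
  have : (rSeq n σ : ℝ) ≤ rSeq n τ := (not_le.mp hσ).le.trans hτ
  exact_mod_cast this

/-- Uniform lower bound for the discrepancy on `B_c` over all `k`-shuffles with `k ≤ m`. -/
theorem discrepancy_on_Bset (a : ℝ) (ha : 0 < a) :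
    ∃ C : ℝ, 0 < C ∧ ∃ N : ℕ, ∀ n m : ℕ, N ≤ n → ∀ hm : 1 ≤ m,
      a < (m : ℝ) * (n : ℝ) ^ (-(3 / 2) : ℝ) →
      |(Finset.Icc 1 m).inf' (Finset.nonempty_Icc.mpr hm)
          (fun k => (∑ σ ∈ Bset n m, Us n σ) - ∑ σ ∈ Bset n m, Qs n k σ) -
        Psi (((m : ℝ) * (n : ℝ) ^ (-(3 / 2) : ℝ))⁻¹)| ≤ C * (n : ℝ) ^ (-(1 / 4) : ℝ) := by
  have hM := gaussFourth_nonneg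
  have ha' : 0 < a⁻¹ := inv_pos.mpr ha
  refine ⟨a⁻¹ + (2 * a⁻¹ ^ 2 + 2 * a⁻¹ ^ 3) * Real.exp (a⁻¹ ^ 2 + 2 * a⁻¹ ^ 3) +
    (28 + 8 * gaussFourth) * a⁻¹, by positivity, ⌈(2 * a⁻¹) ^ 2⌉₊ + 1, ?_⟩
  intro n m hN hm hc
  have hn1 : 1 ≤ n := by omega
  have hN' : (2 * a⁻¹) ^ 2 ≤ (n : ℝ) :=
    (Nat.le_ceil _).trans (by exact_mod_cast (by omega : ⌈(2 * a⁻¹) ^ 2⌉₊ ≤ n))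
  have hn0 : (0 : ℝ) ≤ n := by positivity
  have hnpos : (0 : ℝ) < n := by exact_mod_cast hn1
  set q := (n : ℝ) ^ ((1 : ℝ) / 4) with hq
  have hq1 : 1 ≤ q := Real.one_le_rpow (by exact_mod_cast hn1) (by norm_num)
  have hq0 : 0 < q := by linarith
  have hn4 : (n : ℝ) = q ^ 4 := by
    rw [hq, ← Real.rpow_mul_natCast hn0]
    norm_num
  have h32 : (n : ℝ) ^ (-(3 / 2) : ℝ) = (q ^ 6)⁻¹ := by
    rw [Real.rpow_neg hn0, hq, ← Real.rpow_mul_natCast hn0]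
    norm_num
  have h14 : (n : ℝ) ^ (-(1 / 4) : ℝ) = q⁻¹ := Real.rpow_neg hn0 _
  have hsqrt : Real.sqrt n = q ^ 2 := by
    rw [hn4, show q ^ 4 = (q ^ 2) ^ 2 by ring, Real.sqrt_sq (by positivity)]
  have hB := mem_Bset_iff (m := m) hn1
  rw [inf'_discrepancy_eq hn1 hm hB, sum_Us_sub_sum_Qs n m _ hB]
  set c := (m : ℝ) * (n : ℝ) ^ (-(3 / 2) : ℝ) with hcdef
  have hc0 : 0 < c := ha.trans hc
  have hs : 0 < c⁻¹ := inv_pos.mpr hc0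
  have hsa : c⁻¹ ≤ a⁻¹ := by gcongr
  have hms : (m : ℝ) * c⁻¹ = q ^ 6 := by
    have hm0 : (0 : ℝ) < m := by exact_mod_cast hm
    rw [hcdef, h32]
    field_simp
  have hsq : 2 * c⁻¹ ≤ q ^ 2 := by
    have : 2 * a⁻¹ ≤ q ^ 2 := by
      rw [← hsqrt]
      exact Real.le_sqrt_of_sq_le hN'
    linarith
  have eT : Real.sqrt n / (24 * c) = c⁻¹ * q ^ 2 / 24 := by
    rw [hsqrt]
    field_simp
  rw [eT, h14]
  refine (abs_uniformMean_truncated_sub_Psi_le hq1 hn4 hms hs hsq).trans ?_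
  rw [div_eq_mul_inv]
  gcongr
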